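/- Let $f\in L_p(\mathbb{T})$, $1\le p<\infty$, $r,s\in\mathbb{N}$ with $s\le 2r$, and $\alpha\in(0,s)$. Suppose the sampling operators $G_n$, $n\in\mathbb{N}$, satisfy conditions (c1), (c1'), (c2') and (c4). Then the following are equivalent: (i) $\|f-G_n(f)\|_p=\mathcal{O}(n^{-\alpha})$ as $n\to\infty$; (ii) $\|f_{\gamma/n,\,r}-f\|_{\ell_p(X_n)}+\omega_s(f,1/n)_p=\mathcal{O}(n^{-\alpha})$ as $n\to\infty$. -/

import Mathlib

open MeasureTheory Filter Finset

noncomputable def LpNorm (p : ℝ) (f : ℝ → ℝ) : ℝ :=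
  (∫ x in (0:ℝ)..1, |f x| ^ p) ^ (1 / p)

def MemLpT (p : ℝ) (f : ℝ → ℝ) : Prop :=
  Function.Periodic f 1 ∧ Measurable f ∧
    IntervalIntegrable (fun x => |f x| ^ p) MeasureTheory.volume 0 1

noncomputable def Delta (r : ℕ) (h : ℝ) (f : ℝ → ℝ) (x : ℝ) : ℝ :=
  ∑ ν ∈ Finset.range (r + 1), ((-1 : ℝ) ^ ν * (r.choose ν : ℝ)) * f (x + ((r : ℝ) - (ν : ℝ)) * h)

noncomputable def omegaMod (r : ℕ) (p : ℝ) (f : ℝ → ℝ) (δ : ℝ) : ℝ :=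
  sSup {y | ∃ h : ℝ, 0 < h ∧ h < δ ∧ y = LpNorm p (Delta r h f)}

noncomputable def steklov (r : ℕ) (δ : ℝ) (f : ℝ → ℝ) (x : ℝ) : ℝ :=
  (-1 : ℝ) ^ (r + 1) * (((2 * r).choose r : ℝ))⁻¹ * (2 / δ) *
    ∫ t in (-(δ / 2))..(δ / 2),
      ∑ ν ∈ Finset.range r,
        (-1 : ℝ) ^ ν * (((2 * r).choose ν : ℝ)) * f (x + (((r : ℝ) - (ν : ℝ)) / (r : ℝ)) * t)

noncomputable def ellp (p : ℝ) (n : ℕ) (x : ℕ → ℝ) (f : ℝ → ℝ) : ℝ :=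
  ((1 / (n : ℝ)) * ∑ k ∈ Finset.range n, |f (x k)| ^ p) ^ (1 / p)

def SobolevW (s : ℕ) (g : ℝ → ℝ) : Prop :=
  Function.Periodic g 1 ∧ ContDiff ℝ (s : ℕ∞) g

noncomputable def localMod (r : ℕ) (f : ℝ → ℝ) (x δ : ℝ) : ℝ :=
  sSup {y | ∃ t h : ℝ, t ∈ Set.Icc (x - r * δ / 2) (x + r * δ / 2) ∧
    (t + r * h) ∈ Set.Icc (x - r * δ / 2) (x + r * δ / 2) ∧ y = |Delta r h f t|}

noncomputable def tauMod (r : ℕ) (p : ℝ) (f : ℝ → ℝ) (δ : ℝ) : ℝ :=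
  (∫ x in (0:ℝ)..1, localMod r f x δ ^ p) ^ (1 / p)

def IsTrigPoly (n : ℕ) (T : ℝ → ℝ) : Prop :=
  ∃ c : ℤ → ℂ, ∀ x : ℝ, (T x : ℂ) =
    ∑ ℓ ∈ Finset.Icc (-(n : ℤ)) (n : ℤ),
      c ℓ * Complex.exp (2 * Real.pi * Complex.I * (ℓ : ℂ) * (x : ℂ))

noncomputable def tildeE (n : ℕ) (p : ℝ) (f : ℝ → ℝ) : ℝ :=
  sInf {y | ∃ Q q : ℝ → ℝ, IsTrigPoly n Q ∧ IsTrigPoly n q ∧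
    (∀ x, q x ≤ f x ∧ f x ≤ Q x) ∧ y = LpNorm p (fun x => Q x - q x)}

noncomputable def dirichlet (n : ℕ) (x : ℝ) : ℝ :=
  ∑ ℓ ∈ Finset.Icc (-(n : ℤ)) (n : ℤ), Real.cos (2 * Real.pi * (ℓ : ℝ) * x)

noncomputable def lagrange (n : ℕ) (f : ℝ → ℝ) (x : ℝ) : ℝ :=
  (1 / (2 * (n : ℝ) + 1)) * ∑ k ∈ Finset.range (2 * n + 1),
    f ((k : ℝ) / (2 * (n : ℝ) + 1)) * dirichlet n (x - (k : ℝ) / (2 * (n : ℝ) + 1))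

def NodesOK (γ : ℝ) (X : ℕ → ℕ → ℝ) : Prop :=
  ∀ n : ℕ, 1 ≤ n →
    (0 ≤ X n 0) ∧ (∀ k, k + 1 < n → X n k < X n (k + 1)) ∧ (X n (n - 1) < 1) ∧
    (∀ k, k + 1 < n → γ / (n : ℝ) ≤ X n (k + 1) - X n k) ∧
    (γ / (n : ℝ) ≤ 1 + X n 0 - X n (n - 1))

def NodesOrd (X : ℕ → ℕ → ℝ) : Prop :=
  ∀ n : ℕ, 1 ≤ n →
    (0 ≤ X n 0) ∧ (∀ k, k + 1 < n → X n k < X n (k + 1)) ∧ (X n (n - 1) < 1)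

def SamplingForm (p : ℝ) (X : ℕ → ℕ → ℝ) (φ : ℕ → ℕ → ℝ → ℝ)
    (G : ℕ → (ℝ → ℝ) → ℝ → ℝ) : Prop :=
  (∀ n k, MemLpT p (φ n k)) ∧
  ∀ (n : ℕ) (f : ℝ → ℝ) (x : ℝ), G n f x = ∑ k ∈ Finset.range n, f (X n k) * φ n k x

def CondC1 (p K1 : ℝ) (X : ℕ → ℕ → ℝ) (G : ℕ → (ℝ → ℝ) → ℝ → ℝ) : Prop :=
  ∀ f : ℝ → ℝ, MemLpT p f → ∀ n : ℕ, 1 ≤ n → LpNorm p (G n f) ≤ K1 * ellp p n (X n) f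

def CondC1' (p K2 : ℝ) (X : ℕ → ℕ → ℝ) (G : ℕ → (ℝ → ℝ) → ℝ → ℝ) : Prop :=
  ∀ f : ℝ → ℝ, MemLpT p f → ∀ n : ℕ, 1 ≤ n → K2 * ellp p n (X n) f ≤ LpNorm p (G n f)

def CondC2' (p K3 : ℝ) (s : ℕ) (G : ℕ → (ℝ → ℝ) → ℝ → ℝ) : Prop :=
  ∀ g : ℝ → ℝ, SobolevW s g → ∀ n : ℕ, 1 ≤ n →
    LpNorm p (fun x => g x - G n g x) ≤ K3 / (n : ℝ) ^ s * LpNorm p (iteratedDeriv s g)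

def CondC3 (p K5 : ℝ) (s : ℕ) (G : ℕ → (ℝ → ℝ) → ℝ → ℝ) : Prop :=
  ∀ f : ℝ → ℝ, MemLpT p f → ∀ n : ℕ, 1 ≤ n →
    SobolevW s (G n f) ∧
    (1 / (n : ℝ) ^ s) * LpNorm p (iteratedDeriv s (G n f)) ≤
      K5 * omegaMod s p (G n f) (1 / (n : ℝ))

noncomputable def Gprev (G : ℕ → (ℝ → ℝ) → ℝ → ℝ) (f : ℝ → ℝ) (ν : ℕ) : ℝ → ℝ :=
  if ν = 0 then fun _ => 0 else G (2 ^ (ν - 1)) f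

def CondC4 (p K4 : ℝ) (s : ℕ) (G : ℕ → (ℝ → ℝ) → ℝ → ℝ) (f : ℝ → ℝ) : Prop :=
  ∀ ν : ℕ,
    SobolevW s (fun x => G (2 ^ ν) f x - Gprev G f ν x) ∧
    LpNorm p (iteratedDeriv s (fun x => G (2 ^ ν) f x - Gprev G f ν x)) ≤
      K4 * 2 ^ (s * ν) * LpNorm p (fun x => G (2 ^ ν) f x - Gprev G f ν x)

noncomputable def Kfun (s : ℕ) (p : ℝ) (n : ℕ) (x : ℕ → ℝ) (f : ℝ → ℝ) : ℝ :=
  sInf {y | ∃ g : ℝ → ℝ, SobolevW s g ∧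
    y = ellp p n x (fun t => f t - g t) + LpNorm p (fun t => f t - g t) +
        (1 / (n : ℝ) ^ s) * LpNorm p (iteratedDeriv s g)}



/-! ### Basic facts about the `L_p` norm on the torus -/

/-- Restricted Lebesgue measure on the unit interval. -/
noncomputable def muT : Measure ℝ := volume.restrict (Set.Ioc (0:ℝ) 1)

instance muT_prob : IsProbabilityMeasure muT := by
  constructor
  simp [muT]

lemma memLpT_iff {p : ℝ} (hp : 1 ≤ p) (f : ℝ → ℝ) :
    MemLpT p f ↔ Function.Periodic f 1 ∧ Measurable f ∧ MemLp f (ENNReal.ofReal p) muT := by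
  unfold MemLpT
  refine and_congr_right fun _ => and_congr_right fun hm => ?_
  rw [intervalIntegrable_iff_integrableOn_Ioc_of_le zero_le_one]
  have := integrable_norm_rpow_iff (μ := muT) (p := ENNReal.ofReal p) hm.aestronglyMeasurable
    (by simp; linarith) (by simp)
  rw [ENNReal.toReal_ofReal (by linarith)] at this
  exact this

lemma LpNorm_eq {p : ℝ} (hp : 1 ≤ p) {f : ℝ → ℝ} (hf : MemLpT p f) :
    LpNorm p f = (eLpNorm f (ENNReal.ofReal p) muT).toReal := by
  rw [memLpT_iff hp] at hf
  rw [hf.2.2.eLpNorm_eq_integral_rpow_norm (by simp; linarith) (by simp),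
    ENNReal.toReal_ofReal (by positivity), ENNReal.toReal_ofReal (by linarith)]
  unfold LpNorm muT
  rw [intervalIntegral.integral_of_le zero_le_one]
  simp [Real.norm_eq_abs]

lemma LpNorm_nonneg (p : ℝ) (f : ℝ → ℝ) : 0 ≤ LpNorm p f := by
  unfold LpNorm
  apply Real.rpow_nonneg
  apply intervalIntegral.integral_nonneg zero_le_one
  intros; positivity

lemma LpNorm_rpow {p : ℝ} (hp : 1 ≤ p) (f : ℝ → ℝ) :
    LpNorm p f ^ p = ∫ x in (0:ℝ)..1, |f x| ^ p := by
  unfold LpNorm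
  rw [← Real.rpow_mul, one_div, inv_mul_cancel₀ (by linarith), Real.rpow_one]
  apply intervalIntegral.integral_nonneg zero_le_one
  intros; positivity

lemma eLpNorm_le_of_LpNorm_le {p : ℝ} (hp : 1 ≤ p) {f : ℝ → ℝ} (hf : MemLpT p f) {W : ℝ}
    (h : LpNorm p f ≤ W) : eLpNorm f (ENNReal.ofReal p) muT ≤ ENNReal.ofReal W := by
  rw [LpNorm_eq hp hf] at h
  rw [memLpT_iff hp] at hf
  rw [← ENNReal.ofReal_toReal hf.2.2.eLpNorm_ne_top]
  exact ENNReal.ofReal_le_ofReal h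

lemma memLpT_add {p : ℝ} (hp : 1 ≤ p) {f g : ℝ → ℝ} (hf : MemLpT p f) (hg : MemLpT p g) :
    MemLpT p (fun x => f x + g x) := by
  rw [memLpT_iff hp] at *
  exact ⟨fun x => by simp [hf.1 x, hg.1 x], hf.2.1.add hg.2.1, hf.2.2.add hg.2.2⟩

lemma memLpT_const_mul {p : ℝ} (hp : 1 ≤ p) {f : ℝ → ℝ} (c : ℝ) (hf : MemLpT p f) :
    MemLpT p (fun x => c * f x) := by
  rw [memLpT_iff hp] at *
  exact ⟨fun x => by simp [hf.1 x], hf.2.1.const_mul c, hf.2.2.const_mul c⟩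

lemma memLpT_sub {p : ℝ} (hp : 1 ≤ p) {f g : ℝ → ℝ} (hf : MemLpT p f) (hg : MemLpT p g) :
    MemLpT p (fun x => f x - g x) := by
  rw [memLpT_iff hp] at *
  exact ⟨fun x => by simp [hf.1 x, hg.1 x], hf.2.1.sub hg.2.1, hf.2.2.sub hg.2.2⟩

lemma memLpT_zero {p : ℝ} (hp : 1 ≤ p) : MemLpT p (fun _ => 0) := by
  rw [memLpT_iff hp]
  exact ⟨fun x => rfl, measurable_const, MemLp.zero⟩

lemma memLpT_sum {p : ℝ} (hp : 1 ≤ p) {ι : Type*} (t : Finset ι) {f : ι → ℝ → ℝ}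
    (hf : ∀ i ∈ t, MemLpT p (f i)) : MemLpT p (fun x => ∑ i ∈ t, f i x) := by
  classical
  induction t using Finset.induction_on with
  | empty => simpa using memLpT_zero hp
  | insert a t ha ih =>
    simp only [Finset.sum_insert ha]
    exact memLpT_add hp (hf a (by simp)) (ih fun i hi => hf i (by simp [hi]))

lemma LpNorm_add_le {p : ℝ} (hp : 1 ≤ p) {f g : ℝ → ℝ} (hf : MemLpT p f) (hg : MemLpT p g) :
    LpNorm p (fun x => f x + g x) ≤ LpNorm p f + LpNorm p g := by
  rw [LpNorm_eq hp hf, LpNorm_eq hp hg, LpNorm_eq hp (memLpT_add hp hf hg)]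
  rw [memLpT_iff hp] at hf hg
  rw [← ENNReal.toReal_add hf.2.2.eLpNorm_ne_top hg.2.2.eLpNorm_ne_top]
  refine ENNReal.toReal_mono (by simp [hf.2.2.eLpNorm_ne_top, hg.2.2.eLpNorm_ne_top]) ?_
  exact eLpNorm_add_le hf.2.2.1 hg.2.2.1 (by simpa using hp)

lemma LpNorm_const_mul {p : ℝ} (hp : 1 ≤ p) (f : ℝ → ℝ) (c : ℝ) :
    LpNorm p (fun x => c * f x) = |c| * LpNorm p f := by
  unfold LpNorm
  simp only [abs_mul, Real.mul_rpow (abs_nonneg _) (abs_nonneg _)]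
  rw [intervalIntegral.integral_const_mul, Real.mul_rpow (by positivity), ← Real.rpow_mul
    (abs_nonneg _), mul_one_div_cancel (by linarith), Real.rpow_one]
  apply intervalIntegral.integral_nonneg zero_le_one
  intros; positivity

lemma LpNorm_neg (p : ℝ) (f : ℝ → ℝ) : LpNorm p (fun x => - f x) = LpNorm p f := by
  simp [LpNorm]

lemma LpNorm_sub_comm (p : ℝ) (f g : ℝ → ℝ) :
    LpNorm p (fun x => f x - g x) = LpNorm p (fun x => g x - f x) := by
  simp [LpNorm, abs_sub_comm]

lemma LpNorm_zero {p : ℝ} (hp : 1 ≤ p) : LpNorm p (fun _ => 0) = 0 := by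
  have := LpNorm_const_mul hp (fun _ => 0) 0
  simpa using this

lemma LpNorm_sub_le {p : ℝ} (hp : 1 ≤ p) {f g : ℝ → ℝ} (hf : MemLpT p f) (hg : MemLpT p g) :
    LpNorm p (fun x => f x - g x) ≤ LpNorm p f + LpNorm p g := by
  have := LpNorm_add_le hp hf (memLpT_const_mul hp (-1) hg)
  rw [LpNorm_const_mul hp] at this
  simpa [sub_eq_add_neg] using this

lemma LpNorm_sum_le {p : ℝ} (hp : 1 ≤ p) {ι : Type*} (t : Finset ι) {f : ι → ℝ → ℝ}
    (hf : ∀ i ∈ t, MemLpT p (f i)) :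
    LpNorm p (fun x => ∑ i ∈ t, f i x) ≤ ∑ i ∈ t, LpNorm p (f i) := by
  classical
  induction t using Finset.induction_on with
  | empty => simp [LpNorm_zero hp]
  | insert a t ha ih =>
    simp only [Finset.sum_insert ha]
    have h2 := ih fun i hi => hf i (by simp [hi])
    have := LpNorm_add_le hp (hf a (by simp))
      (memLpT_sum hp t (fun i hi => hf i (by simp [hi])))
    linarith

lemma memLpT_shift {p : ℝ} {f : ℝ → ℝ} (a : ℝ) (hf : MemLpT p f) :
    MemLpT p (fun x => f (x + a)) := by
  obtain ⟨h1, h2, h3⟩ := hf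
  refine ⟨fun x => by simp only []; rw [show x + 1 + a = x + a + 1 by ring, h1], by fun_prop, ?_⟩
  have hper : Function.Periodic (fun x => |f x| ^ p) 1 := fun x => by simp [h1 x]
  have := hper.intervalIntegrable₀ one_ne_zero h3 (0 + a) (1 + a)
  have := this.comp_add_right a
  simpa using this

lemma LpNorm_shift {p : ℝ} {f : ℝ → ℝ} (a : ℝ) (hf : MemLpT p f) :
    LpNorm p (fun x => f (x + a)) = LpNorm p f := by
  unfold LpNorm
  have hper : Function.Periodic (fun x => |f x| ^ p) 1 := fun x => by simp [hf.1 x]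
  congr 1
  have := intervalIntegral.integral_comp_add_right (a := 0) (b := 1) (fun x => |f x| ^ p) a
  rw [this, show (1:ℝ) + a = a + 1 by ring, zero_add, hper.intervalIntegral_add_eq a 0, zero_add]

/-- Continuous periodic functions are in `L_p`. -/
lemma memLpT_of_continuous {p : ℝ} (hp : 1 ≤ p) {f : ℝ → ℝ} (hper : Function.Periodic f 1)
    (hf : Continuous f) : MemLpT p f :=
  ⟨hper, hf.measurable, (hf.abs.rpow_const (fun _ => Or.inr (by linarith))).intervalIntegrable _ _⟩

/-- locally integrable -/
def LI (f : ℝ → ℝ) : Prop := ∀ a b, IntervalIntegrable f volume a b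

lemma MemLpT.li {p : ℝ} (hp : 1 ≤ p) {f : ℝ → ℝ} (hf : MemLpT p f) : LI f := by
  have h1 := hf.1
  rw [memLpT_iff hp] at hf
  have h2 : Integrable f muT := hf.2.2.integrable (by simpa using hp)
  have h3 : IntervalIntegrable f volume 0 1 :=
    (intervalIntegrable_iff_integrableOn_Ioc_of_le zero_le_one).2 h2
  intro a b
  exact h1.intervalIntegrable₀ one_ne_zero h3 a b

lemma MemLpT.li_pow {p : ℝ} {f : ℝ → ℝ} (hf : MemLpT p f) : LI (fun x => |f x| ^ p) := by
  have hper : Function.Periodic (fun x => |f x| ^ p) 1 := fun x => by simp [hf.1 x]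
  exact fun a b => hper.intervalIntegrable₀ one_ne_zero hf.2.2 a b

lemma LI.comp_affine {f : ℝ → ℝ} (hf : LI f) (a c : ℝ) : LI (fun u => f (a + c * u)) := by
  intro x y
  rcases eq_or_ne c 0 with rfl | hc
  · simp
  have := (hf (a + c * x) (a + c * y)).comp_add_left a
  have := this.comp_mul_left (c := c)
  simpa [hc] using this

/-- Minkowski's integral inequality over the unit interval. -/
lemma minkowski {p : ℝ} (hp : 1 ≤ p) (Φ : ℝ → ℝ → ℝ) (hΦ : Measurable (Function.uncurry Φ))
    (W : ℝ) (h : ∀ u ∈ Set.Ioc (0:ℝ) 1, MemLpT p (Φ u) ∧ LpNorm p (Φ u) ≤ W)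
    (hper : ∀ u, Function.Periodic (Φ u) 1) :
    MemLpT p (fun x => ∫ u in (0:ℝ)..1, Φ u x) ∧
      LpNorm p (fun x => ∫ u in (0:ℝ)..1, Φ u x) ≤ W := by
  have hp0 : 0 < p := by linarith
  have hW : 0 ≤ W := (LpNorm_nonneg _ _).trans (h 1 (by simp)).2
  have hI : (fun x => ∫ u in (0:ℝ)..1, Φ u x) = fun x => ∫ u, Φ u x ∂muT := by
    ext x; rw [intervalIntegral.integral_of_le zero_le_one]; rfl
  rw [hI]
  have hq0 : ENNReal.ofReal p ≠ 0 := by simp; linarith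
  have hqt : ENNReal.ofReal p ≠ ⊤ := by simp
  have hqr : (ENNReal.ofReal p).toReal = p := ENNReal.toReal_ofReal (by linarith)
  have hmeas : Measurable (fun x => ∫ u, Φ u x ∂muT) := by
    have : StronglyMeasurable (fun x => ∫ u, (fun z : ℝ × ℝ => Φ z.2 z.1) (x, u) ∂muT) :=
      StronglyMeasurable.integral_prod_right' (f := fun z : ℝ × ℝ => Φ z.2 z.1)
        ((hΦ.comp measurable_swap).stronglyMeasurable)
    exact this.measurable
  have key : eLpNorm (fun x => ∫ u, Φ u x ∂muT) (ENNReal.ofReal p) muT ≤ ENNReal.ofReal W := by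
    rw [eLpNorm_eq_lintegral_rpow_enorm_toReal hq0 hqt, hqr, one_div,
      ENNReal.rpow_inv_le_iff hp0]
    calc ∫⁻ x, ‖∫ u, Φ u x ∂muT‖ₑ ^ p ∂muT
        ≤ ∫⁻ x, ∫⁻ u, ‖Φ u x‖ₑ ^ p ∂muT ∂muT := by
          apply lintegral_mono
          intro x
          have hx : AEStronglyMeasurable (fun u => Φ u x) muT :=
            (hΦ.comp (measurable_id.prodMk measurable_const)).aestronglyMeasurable
          have h1 := eLpNorm_le_eLpNorm_of_exponent_le (p := 1) (q := ENNReal.ofReal p) (μ := muT)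
            (by simpa using hp) hx
          rw [eLpNorm_one_eq_lintegral_enorm, eLpNorm_eq_lintegral_rpow_enorm_toReal hq0 hqt, hqr,
            one_div, ENNReal.le_rpow_inv_iff hp0] at h1
          exact (ENNReal.rpow_le_rpow (enorm_integral_le_lintegral_enorm _) hp0.le).trans h1
      _ = ∫⁻ u, ∫⁻ x, ‖Φ u x‖ₑ ^ p ∂muT ∂muT := by
          rw [lintegral_lintegral_swap]
          have : Measurable (fun z : ℝ × ℝ => ‖Φ z.2 z.1‖ₑ ^ p) :=
            ((hΦ.comp measurable_swap).enorm).pow_const p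
          exact this.aemeasurable
      _ ≤ ∫⁻ u, ENNReal.ofReal W ^ p ∂muT := by
          apply lintegral_mono_ae
          filter_upwards [ae_restrict_mem measurableSet_Ioc] with u hu
          have h1 := eLpNorm_le_of_LpNorm_le hp (h u hu).1 (h u hu).2
          rwa [eLpNorm_eq_lintegral_rpow_enorm_toReal hq0 hqt, hqr, one_div,
            ENNReal.rpow_inv_le_iff hp0] at h1
      _ = ENNReal.ofReal W ^ p := by simp
  have hmem : MemLpT p (fun x => ∫ u, Φ u x ∂muT) := by
    rw [memLpT_iff hp]
    refine ⟨fun x => ?_, hmeas, hmeas.aestronglyMeasurable, key.trans_lt (by simp)⟩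
    simp only [hper _ x]
  refine ⟨hmem, ?_⟩
  rw [LpNorm_eq hp hmem]
  exact ENNReal.toReal_le_of_le_ofReal hW key


/-! ### Averages and differences -/

/-- Average of `F` over `[x, x + h]`. -/
noncomputable def Av (h : ℝ) (F : ℝ → ℝ) (x : ℝ) : ℝ := ∫ u in (0:ℝ)..1, F (x + h * u)

lemma Av_zero (F : ℝ → ℝ) : Av 0 F = F := by
  ext x; simp [Av]

lemma Delta_eq' (r : ℕ) (h : ℝ) (f : ℝ → ℝ) (x : ℝ) :
    Delta r h f x =
      ∑ k ∈ Finset.range (r + 1), ((-1 : ℝ) ^ (r - k) * (r.choose k : ℝ)) * f (x + k * h) := by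
  unfold Delta
  rw [← Finset.sum_range_reflect]
  apply Finset.sum_congr rfl
  intro k hk
  have hk' : k ≤ r := by simpa [Nat.lt_succ_iff] using hk
  rw [show r + 1 - 1 - k = r - k by omega, Nat.choose_symm hk', Nat.cast_sub hk']
  ring_nf

lemma Delta_iter (r : ℕ) (h : ℝ) (f : ℝ → ℝ) : Delta r h f = (fwdDiff h)^[r] f := by
  ext x
  rw [Delta_eq', fwdDiff_iter_eq_sum_shift]
  apply Finset.sum_congr rfl
  intro k hk
  simp

lemma Delta_zero (h : ℝ) (f : ℝ → ℝ) : Delta 0 h f = f := by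
  rw [Delta_iter]; rfl

lemma Delta_succ (r : ℕ) (h : ℝ) (f : ℝ → ℝ) (x : ℝ) :
    Delta (r + 1) h f x = Delta r h f (x + h) - Delta r h f x := by
  rw [Delta_iter, Delta_iter, Function.iterate_succ_apply']; rfl

lemma Delta_add_order (m r : ℕ) (h : ℝ) (f : ℝ → ℝ) :
    Delta (m + r) h f = Delta m h (Delta r h f) := by
  rw [Delta_iter, Delta_iter, Delta_iter, Function.iterate_add_apply]

lemma Delta_sub (r : ℕ) (h : ℝ) (f g : ℝ → ℝ) (x : ℝ) :
    Delta r h (fun x => f x - g x) x = Delta r h f x - Delta r h g x := by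
  simp only [Delta, mul_sub, Finset.sum_sub_distrib]

lemma Delta_h_zero {r : ℕ} (hr : 1 ≤ r) (f : ℝ → ℝ) : Delta r 0 f = fun _ => 0 := by
  obtain ⟨m, rfl⟩ := Nat.exists_eq_add_of_le' hr
  ext x
  simp [Delta_succ]

lemma memLpT_Delta {p : ℝ} (hp : 1 ≤ p) (r : ℕ) (h : ℝ) {f : ℝ → ℝ} (hf : MemLpT p f) :
    MemLpT p (Delta r h f) := by
  unfold Delta
  exact memLpT_sum hp _ fun i _ => memLpT_const_mul hp _ (memLpT_shift _ hf)

lemma LpNorm_Delta_le {p : ℝ} (hp : 1 ≤ p) (r : ℕ) (h : ℝ) {f : ℝ → ℝ} (hf : MemLpT p f) :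
    LpNorm p (Delta r h f) ≤ 2 ^ r * LpNorm p f := by
  induction r with
  | zero => simp [Delta_zero]
  | succ r ih =>
    have h1 := memLpT_Delta hp r h hf
    have h2 := LpNorm_sub_le hp (memLpT_shift h h1) h1
    rw [LpNorm_shift h h1] at h2
    have h3 : Delta (r + 1) h f = fun x => Delta r h f (x + h) - Delta r h f x := by
      ext x; exact Delta_succ ..
    rw [h3, pow_succ]
    linarith

lemma omega_bdd {p : ℝ} (hp : 1 ≤ p) (s : ℕ) (δ : ℝ) {f : ℝ → ℝ} (hf : MemLpT p f) :
    BddAbove {y | ∃ h : ℝ, 0 < h ∧ h < δ ∧ y = LpNorm p (Delta s h f)} := by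
  refine ⟨2 ^ s * LpNorm p f, ?_⟩
  rintro y ⟨h, -, -, rfl⟩
  exact LpNorm_Delta_le hp s h hf

lemma le_omega {p : ℝ} (hp : 1 ≤ p) (s : ℕ) (δ : ℝ) {f : ℝ → ℝ} (hf : MemLpT p f) {h : ℝ}
    (h0 : 0 < h) (h1 : h < δ) : LpNorm p (Delta s h f) ≤ omegaMod s p f δ :=
  le_csSup (omega_bdd hp s δ hf) ⟨h, h0, h1, rfl⟩

lemma omega_nonneg (p : ℝ) (s : ℕ) (δ : ℝ) (f : ℝ → ℝ) : 0 ≤ omegaMod s p f δ := by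
  apply Real.sSup_nonneg
  rintro y ⟨h, -, -, rfl⟩
  exact LpNorm_nonneg _ _

lemma Av_memLpT {p : ℝ} (hp : 1 ≤ p) (h : ℝ) {f : ℝ → ℝ} (hf : MemLpT p f) :
    MemLpT p (Av h f) ∧ LpNorm p (Av h f) ≤ LpNorm p f := by
  refine minkowski hp (fun u x => f (x + h * u)) ?_ _ ?_ ?_
  · have := hf.2.1
    unfold Function.uncurry
    fun_prop
  · intro u _
    exact ⟨memLpT_shift _ hf, (LpNorm_shift _ hf).le⟩
  · intro u
    exact (memLpT_shift _ hf).1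

lemma Av_Delta (m : ℕ) (h k : ℝ) {F : ℝ → ℝ} (hF : LI F) :
    Av h (Delta m k F) = Delta m k (Av h F) := by
  ext x
  unfold Av Delta
  rw [intervalIntegral.integral_finsetSum]
  · apply Finset.sum_congr rfl
    intro i _
    rw [intervalIntegral.integral_const_mul]
    congr 2
    ext u; congr 1; ring
  · intro i _
    have := (hF.comp_affine (x + (m - i) * k) h 0 1).const_mul ((-1 : ℝ) ^ i * (m.choose i : ℝ))
    refine this.congr (fun u _ => ?_)
    rw [show x + (↑m - ↑i) * k + h * u = x + h * u + (↑m - ↑i) * k by ring]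

lemma Av_eq {h : ℝ} (hh : h ≠ 0) (F : ℝ → ℝ) (x : ℝ) :
    Av h F x = h⁻¹ * ∫ t in x..(x + h), F t := by
  unfold Av
  have := intervalIntegral.integral_comp_add_mul (a := 0) (b := 1) F hh x
  rw [this]; simp

lemma Av_continuous {h : ℝ} (hh : h ≠ 0) {F : ℝ → ℝ} (hF : LI F) : Continuous (Av h F) := by
  have h1 : Continuous fun b => ∫ x in (0:ℝ)..b, F x := intervalIntegral.continuous_primitive hF 0
  have h2 : Av h F = fun x => h⁻¹ * ((∫ t in (0:ℝ)..(x + h), F t) - ∫ t in (0:ℝ)..x, F t) := by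
    ext x
    rw [Av_eq hh, intervalIntegral.integral_interval_sub_left (hF _ _) (hF _ _)]
  rw [h2]
  fun_prop

lemma Av_hasDerivAt {h : ℝ} (hh : h ≠ 0) {F : ℝ → ℝ} (hF : Continuous F) (x : ℝ) :
    HasDerivAt (Av h F) (h⁻¹ * (F (x + h) - F x)) x := by
  have hI : ∀ a b, IntervalIntegrable F volume a b := fun a b => hF.intervalIntegrable a b
  have h2 : Av h F = fun x => h⁻¹ * ((∫ t in (0:ℝ)..(x + h), F t) - ∫ t in (0:ℝ)..x, F t) := by
    ext x
    rw [Av_eq hh, intervalIntegral.integral_interval_sub_left (hI _ _) (hI _ _)]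
  rw [h2]
  have h3 : ∀ y, HasDerivAt (fun b => ∫ x in (0:ℝ)..b, F x) (F y) y := fun y =>
    intervalIntegral.integral_hasDerivAt_right (hI _ _)
      hF.stronglyMeasurable.stronglyMeasurableAtFilter hF.continuousAt
  have h4 : HasDerivAt (fun y => ∫ x in (0:ℝ)..(y + h), F x) (F (x + h)) x :=
    (h3 (x + h)).comp_add_const x h
  exact (h4.sub (h3 x)).const_mul _

lemma Continuous.li {F : ℝ → ℝ} (hF : Continuous F) : LI F := fun a b => hF.intervalIntegrable a b

lemma Av_iter_contDiff {h : ℝ} (hh : h ≠ 0) {F : ℝ → ℝ} (hF : Continuous F) (m : ℕ) :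
    ContDiff ℝ m ((Av h)^[m] F) ∧
      iteratedDeriv m ((Av h)^[m] F) = fun x => (h ^ m)⁻¹ * Delta m h F x := by
  induction m with
  | zero => simpa [Delta_zero] using hF
  | succ m ih =>
    obtain ⟨h1, h2⟩ := ih
    set B := (Av h)^[m] F with hB
    have hd := fun x => Av_hasDerivAt hh h1.continuous x
    have hd' : deriv (Av h B) = fun x => h⁻¹ * (B (x + h) - B x) := by
      ext x; exact (hd x).deriv
    rw [Function.iterate_succ_apply', ← hB]
    have hsh : ContDiff ℝ m (fun x => B (x + h)) := h1.comp (by fun_prop)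
    constructor
    · rw [show ((m + 1 : ℕ) : WithTop ℕ∞) = (m : WithTop ℕ∞) + 1 by push_cast; rfl,
        contDiff_succ_iff_deriv]
      refine ⟨fun x => (hd x).differentiableAt, by simp, ?_⟩
      rw [hd']
      exact contDiff_const.mul (hsh.sub h1)
    · rw [iteratedDeriv_succ', hd']
      ext x
      rw [iteratedDeriv_const_mul_field, iteratedDeriv_fun_sub hsh.contDiffAt h1.contDiffAt,
        iteratedDeriv_comp_add_const, h2, Delta_succ]
      simp only [pow_succ]
      field_simp

lemma Delta_hasDerivAt (m : ℕ) (h : ℝ) {g : ℝ → ℝ} (hg : Differentiable ℝ g) (x : ℝ) :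
    HasDerivAt (Delta m h g) (Delta m h (deriv g) x) x := by
  unfold Delta
  apply HasDerivAt.fun_sum
  intro i _
  apply HasDerivAt.const_mul
  exact HasDerivAt.comp_add_const x _ (hg _).hasDerivAt

lemma Delta_continuous (m : ℕ) (h : ℝ) {g : ℝ → ℝ} (hg : Continuous g) :
    Continuous (Delta m h g) := by
  unfold Delta
  fun_prop

lemma Delta_succ_eq_Av (m : ℕ) (h : ℝ) {g : ℝ → ℝ} (hg : ContDiff ℝ 1 g) (x : ℝ) :
    Delta (m + 1) h g x = h * Av h (Delta m h (deriv g)) x := by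
  have hd : Differentiable ℝ g := hg.differentiable (by simp)
  have hc : Continuous (deriv g) := hg.continuous_deriv (by simp)
  rcases eq_or_ne h 0 with rfl | hh
  · simp [Delta_succ]
  rw [Av_eq hh, Delta_succ, intervalIntegral.integral_eq_sub_of_hasDerivAt
    (fun y _ => Delta_hasDerivAt m h hd y) ((Delta_continuous m h hc).intervalIntegrable _ _)]
  field_simp

lemma periodic_deriv {g : ℝ → ℝ} (hg : Function.Periodic g 1) : Function.Periodic (deriv g) 1 := by
  intro x
  rw [← deriv_comp_add_const, show (fun x => g (x + 1)) = g from funext hg]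

lemma periodic_iteratedDeriv {g : ℝ → ℝ} (hg : Function.Periodic g 1) (s : ℕ) :
    Function.Periodic (iteratedDeriv s g) 1 := by
  induction s generalizing g with
  | zero => simpa using hg
  | succ s ih => rw [iteratedDeriv_succ']; exact ih (periodic_deriv hg)

lemma LpNorm_Delta_le_deriv {p : ℝ} (hp : 1 ≤ p) (s : ℕ) (h : ℝ) {g : ℝ → ℝ}
    (hper : Function.Periodic g 1) (hg : ContDiff ℝ s g) :
    LpNorm p (Delta s h g) ≤ |h| ^ s * LpNorm p (iteratedDeriv s g) := by
  induction s generalizing g with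
  | zero => simp [Delta_zero]
  | succ s ih =>
    have hg1 : ContDiff ℝ 1 g := hg.of_le (by norm_cast; omega)
    have hg2 : ContDiff ℝ s (deriv g) := by
      rw [show ((s + 1 : ℕ) : WithTop ℕ∞) = (s : WithTop ℕ∞) + 1 by push_cast; rfl,
        contDiff_succ_iff_deriv] at hg
      exact hg.2.2
    have h1 : Delta (s + 1) h g = fun x => h * Av h (Delta s h (deriv g)) x := by
      ext x; exact Delta_succ_eq_Av s h hg1 x
    have hm : MemLpT p (Delta s h (deriv g)) :=
      memLpT_Delta hp s h (memLpT_of_continuous hp (periodic_deriv hper) hg2.continuous)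
    rw [h1, LpNorm_const_mul hp, iteratedDeriv_succ', pow_succ]
    have h2 := (Av_memLpT hp h hm).2
    have h3 := ih (periodic_deriv hper) hg2
    calc |h| * LpNorm p (Av h (Delta s h (deriv g))) ≤
        |h| * (|h| ^ s * LpNorm p (iteratedDeriv s (deriv g))) := by gcongr; linarith
      _ = _ := by ring

/-- Pointwise bound of a difference by an integral of the derivative. -/
lemma Delta_local (m : ℕ) (u a b : ℝ) {g : ℝ → ℝ} (hg : ContDiff ℝ ((m + 1 : ℕ)) g) (y : ℝ)
    (hy : y ∈ Set.Icc a b) (hy' : y + (m + 1) * u ∈ Set.Icc a b) :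
    |Delta (m + 1) u g y| ≤ |u| ^ m * ∫ t in a..b, |iteratedDeriv (m + 1) g t| := by
  induction m generalizing g y with
  | zero =>
    have hg1 : ContDiff ℝ 1 g := by simpa using hg
    have hc : Continuous (deriv g) := hg1.continuous_deriv (by simp)
    have h1 : Delta (0 + 1) u g y = ∫ t in y..(y + u), deriv g t := by
      rw [Delta_succ, Delta_zero, intervalIntegral.integral_deriv_eq_sub
        (fun x _ => (hg1.differentiable (by simp)) x) (hc.intervalIntegrable _ _)]
    rw [h1]
    simp only [Nat.cast_zero, zero_add, one_mul] at hy'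
    simp only [pow_zero, one_mul, zero_add, iteratedDeriv_one]
    have hab : a ≤ b := hy.1.trans hy.2
    rw [← Real.norm_eq_abs]
    refine (intervalIntegral.norm_integral_le_integral_norm_uIoc).trans ?_
    rw [intervalIntegral.integral_of_le hab]
    refine setIntegral_mono_set ?_ ?_ ?_
    · exact (intervalIntegrable_iff_integrableOn_Ioc_of_le hab).1 (hc.abs.intervalIntegrable _ _)
    · exact Filter.Eventually.of_forall fun x => abs_nonneg _
    · apply LE.le.eventuallyLE
      exact Set.Ioc_subset_Ioc (le_min hy.1 hy'.1) (max_le hy.2 hy'.2)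
  | succ m ih =>
    have hg1 : ContDiff ℝ 1 g := hg.of_le (by norm_cast; omega)
    have hg2 : ContDiff ℝ ((m + 1 : ℕ)) (deriv g) := by
      rw [show ((m + 1 + 1 : ℕ) : WithTop ℕ∞) = ((m + 1 : ℕ) : WithTop ℕ∞) + 1 by push_cast; rfl,
        contDiff_succ_iff_deriv] at hg
      exact hg.2.2
    rw [Delta_succ_eq_Av (m + 1) u hg1, abs_mul, pow_succ', mul_assoc]
    gcongr
    unfold Av
    have := intervalIntegral.norm_integral_le_of_norm_le_const (a := 0) (b := 1)
      (f := fun v => Delta (m + 1) u (deriv g) (y + u * v))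
      (C := |u| ^ m * ∫ t in a..b, |iteratedDeriv (m + 1 + 1) g t|) ?_
    · simpa using this
    · intro v hv
      rw [Set.uIoc_of_le zero_le_one] at hv
      rw [Real.norm_eq_abs, iteratedDeriv_succ']
      have hmm : (0:ℝ) ≤ m := Nat.cast_nonneg m
      push_cast at hy'
      obtain ⟨hv0, hv1⟩ := hv
      refine ih hg2 _ ?_ ?_
      · rcases le_total 0 u with hu | hu
        · constructor <;> nlinarith [hy.1, hy.2, hy'.1, hy'.2, mul_nonneg hmm hu, mul_nonneg hu hv0.le]
        · constructor <;> nlinarith [hy.1, hy.2, hy'.1, hy'.2, mul_nonneg hmm (neg_nonneg.2 hu), mul_nonneg (neg_nonneg.2 hu) hv0.le]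
      · rcases le_total 0 u with hu | hu
        · constructor <;> nlinarith [hy.1, hy.2, hy'.1, hy'.2, mul_nonneg hmm hu, mul_nonneg hu hv0.le]
        · constructor <;> nlinarith [hy.1, hy.2, hy'.1, hy'.2, mul_nonneg hmm (neg_nonneg.2 hu), mul_nonneg (neg_nonneg.2 hu) hv0.le]


/-! ### Discrete norms -/

lemma ellp_nonneg (p : ℝ) (n : ℕ) (x : ℕ → ℝ) (f : ℝ → ℝ) : 0 ≤ ellp p n x f := by
  unfold ellp; positivity

lemma ellp_neg (p : ℝ) (n : ℕ) (x : ℕ → ℝ) (f g : ℝ → ℝ) :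
    ellp p n x (fun t => f t - g t) = ellp p n x (fun t => g t - f t) := by
  simp [ellp, abs_sub_comm]

lemma ellp_add_le {p : ℝ} (hp : 1 ≤ p) (n : ℕ) (x : ℕ → ℝ) (f g : ℝ → ℝ) :
    ellp p n x (fun t => f t + g t) ≤ ellp p n x f + ellp p n x g := by
  unfold ellp
  have h := Real.Lp_add_le (Finset.range n) (fun k => f (x k)) (fun k => g (x k)) hp
  have hs : ∀ F : ℕ → ℝ, 0 ≤ ∑ k ∈ Finset.range n, |F k| ^ p := fun F => by positivity
  rw [Real.mul_rpow (by positivity) (hs _), Real.mul_rpow (by positivity) (hs fun k => f (x k)),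
    Real.mul_rpow (by positivity) (hs fun k => g (x k)), ← mul_add]
  exact mul_le_mul_of_nonneg_left h (by positivity)

lemma nodes_sum {γ : ℝ} {X : ℕ → ℕ → ℝ} (hγ : 0 < γ) (hX : NodesOK γ X) {n : ℕ} (hn : 1 ≤ n)
    {F : ℝ → ℝ} (hF : LI F) (hper : Function.Periodic F 1) (h0 : ∀ x, 0 ≤ F x) :
    ∑ k ∈ Finset.range n, ∫ t in (X n k - γ / n / 2)..(X n k - γ / n / 2 + γ / n), F t ≤
      ∫ t in (0:ℝ)..1, F t := by
  obtain ⟨hX0, hX1, hX2, hX3, hX4⟩ := hX n hn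
  have hδ : 0 < γ / n := by positivity
  set δ := γ / (n:ℝ) with hδd
  have key : ∀ m, m < n → ∑ k ∈ Finset.range (m + 1), ∫ t in (X n k - δ / 2)..(X n k - δ / 2 + δ), F t
      ≤ ∫ t in (X n 0 - δ / 2)..(X n m - δ / 2 + δ), F t := by
    intro m
    induction m with
    | zero => simp
    | succ m ih =>
      intro hm
      rw [Finset.sum_range_succ]
      have h1 := ih (by omega)
      have h2 := hX3 m hm
      have h3 : 0 ≤ ∫ t in (X n m - δ / 2 + δ)..(X n (m + 1) - δ / 2), F t :=
        intervalIntegral.integral_nonneg (by linarith) fun x _ => h0 x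
      have h4 := intervalIntegral.integral_add_adjacent_intervals
        (hF (X n 0 - δ / 2) (X n m - δ / 2 + δ)) (hF _ (X n (m + 1) - δ / 2))
      have h5 := intervalIntegral.integral_add_adjacent_intervals
        (hF (X n 0 - δ / 2) (X n (m + 1) - δ / 2)) (hF _ (X n (m + 1) - δ / 2 + δ))
      linarith
  have h1 := key (n - 1) (by omega)
  rw [show n - 1 + 1 = n by omega] at h1
  have h2 := hper.intervalIntegral_add_eq (X n 0 - δ / 2) 0
  rw [zero_add] at h2
  have h3 : 0 ≤ ∫ t in (X n (n - 1) - δ / 2 + δ)..(X n 0 - δ / 2 + 1), F t :=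
    intervalIntegral.integral_nonneg (by linarith) fun x _ => h0 x
  have h4 := intervalIntegral.integral_add_adjacent_intervals
    (hF (X n 0 - δ / 2) (X n (n - 1) - δ / 2 + δ)) (hF _ (X n 0 - δ / 2 + 1))
  linarith

lemma Av_jensen {p : ℝ} (hp : 1 ≤ p) {F : ℝ → ℝ} (hF : MemLpT p F) (δ y : ℝ) :
    (Av δ (fun t => |F t|) y) ^ p ≤ Av δ (fun t => |F t| ^ p) y := by
  unfold Av
  rw [intervalIntegral.integral_of_le zero_le_one, intervalIntegral.integral_of_le zero_le_one]
  have h1 : IntervalIntegrable (fun u => F (y + δ * u)) volume 0 1 := (hF.li hp).comp_affine y δ 0 1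
  have h2 : IntervalIntegrable (fun u => |F (y + δ * u)| ^ p) volume 0 1 :=
    LI.comp_affine (f := fun t => |F t| ^ p) hF.li_pow y δ 0 1
  rw [intervalIntegrable_iff_integrableOn_Ioc_of_le zero_le_one] at h1 h2
  exact (convexOn_rpow hp).map_integral_le (μ := muT) (f := fun u => |F (y + δ * u)|)
    (Real.continuous_rpow_const (by linarith)).continuousOn isClosed_Ici
    (Filter.Eventually.of_forall fun x => Set.mem_Ici.2 (abs_nonneg _)) h1.abs h2

lemma ellp_le {p γ : ℝ} (hp : 1 ≤ p) {X : ℕ → ℕ → ℝ} (hγ : 0 < γ) (hγ1 : γ ≤ 1)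
    (hX : NodesOK γ X) {n : ℕ} (hn : 1 ≤ n) {F : ℝ → ℝ} (hF : MemLpT p F) {a : ℝ → ℝ} {C : ℝ}
    (hC : 0 ≤ C) (h : ∀ x, |a x| ≤ C * Av (γ / n) (fun t => |F t|) (x - γ / n / 2)) :
    ellp p n (X n) a ≤ C * γ⁻¹ * LpNorm p F := by
  have hn0 : (0:ℝ) < n := by exact_mod_cast hn
  have hδ : 0 < γ / n := by positivity
  have hp0 : 0 < p := by linarith
  have hL := LpNorm_nonneg p F
  unfold ellp
  rw [one_div p, Real.rpow_inv_le_iff_of_pos (by positivity) (by positivity) hp0]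
  have hper : Function.Periodic (fun x => |F x| ^ p) 1 := fun x => by simp [hF.1 x]
  have h1 := nodes_sum hγ hX hn hF.li_pow hper (fun x => by positivity)
  rw [← LpNorm_rpow hp] at h1
  have h2 : ∀ k ∈ Finset.range n, |a (X n k)| ^ p ≤ C ^ p * ((γ / n)⁻¹ *
      ∫ t in (X n k - γ / n / 2)..(X n k - γ / n / 2 + γ / n), |F t| ^ p) := by
    intro k _
    have h3 : 0 ≤ Av (γ / n) (fun t => |F t|) (X n k - γ / n / 2) := by
      unfold Av
      exact intervalIntegral.integral_nonneg zero_le_one fun _ _ => abs_nonneg _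
    calc |a (X n k)| ^ p ≤ (C * Av (γ / n) (fun t => |F t|) (X n k - γ / n / 2)) ^ p :=
          Real.rpow_le_rpow (abs_nonneg _) (h _) hp0.le
      _ = C ^ p * (Av (γ / n) (fun t => |F t|) (X n k - γ / n / 2)) ^ p := Real.mul_rpow hC h3
      _ ≤ C ^ p * (Av (γ / n) (fun t => |F t| ^ p) (X n k - γ / n / 2)) := by
          gcongr; exact Av_jensen hp hF _ _
      _ = _ := by rw [Av_eq hδ.ne']
  have h4 : γ⁻¹ ≤ γ⁻¹ ^ p := by
    have := Real.rpow_le_rpow_of_exponent_le ((one_le_inv₀ hγ).2 hγ1) hp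
    simpa using this
  calc 1 / (n:ℝ) * ∑ k ∈ Finset.range n, |a (X n k)| ^ p
      ≤ 1 / (n:ℝ) * ∑ k ∈ Finset.range n, C ^ p * ((γ / n)⁻¹ *
      ∫ t in (X n k - γ / n / 2)..(X n k - γ / n / 2 + γ / n), |F t| ^ p) := by
        gcongr with k hk; exact h2 k hk
    _ = γ⁻¹ * (C ^ p * ∑ k ∈ Finset.range n,
      ∫ t in (X n k - γ / n / 2)..(X n k - γ / n / 2 + γ / n), |F t| ^ p) := by
        rw [← Finset.mul_sum, ← Finset.mul_sum]
        generalize (∑ k ∈ Finset.range n,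
          ∫ t in (X n k - γ / n / 2)..(X n k - γ / n / 2 + γ / n), |F t| ^ p) = S
        field_simp
    _ ≤ γ⁻¹ * (C ^ p * LpNorm p F ^ p) := by gcongr
    _ ≤ γ⁻¹ ^ p * (C ^ p * LpNorm p F ^ p) := by gcongr
    _ = (C * γ⁻¹ * LpNorm p F) ^ p := by
        rw [Real.mul_rpow (by positivity) hL, Real.mul_rpow hC (by positivity)]; ring

/-! ### The Steklov operator -/

lemma steklov_integrand_li (r : ℕ) {f : ℝ → ℝ} (hf : LI f) (x : ℝ) (ν : ℕ) (c : ℝ) :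
    LI (fun t => c * f (x + (((r : ℝ) - (ν : ℝ)) / (r : ℝ)) * t)) :=
  fun a b => (hf.comp_affine x _ a b).const_mul c

lemma li_sum {ι : Type*} (t : Finset ι) {f : ι → ℝ → ℝ} (hf : ∀ i ∈ t, LI (f i)) :
    LI (fun x => ∑ i ∈ t, f i x) := by
  intro a b
  classical
  induction t using Finset.induction_on with
  | empty => simp
  | insert c t ha ih =>
    simp only [Finset.sum_insert ha]
    exact (hf c (by simp) a b).add (ih fun i hi => hf i (by simp [hi]))

lemma steklov_sub (r : ℕ) (δ : ℝ) {f g : ℝ → ℝ} (hf : LI f) (hg : LI g) (x : ℝ) :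
    steklov r δ (fun t => f t - g t) x = steklov r δ f x - steklov r δ g x := by
  unfold steklov
  rw [← mul_sub, ← intervalIntegral.integral_sub]
  · simp only [mul_sub, Finset.sum_sub_distrib]
  · exact li_sum _ (fun i _ => steklov_integrand_li r hf x i _) _ _
  · exact li_sum _ (fun i _ => steklov_integrand_li r hg x i _) _ _

lemma choose_inv_le (r : ℕ) : (((2 * r).choose r : ℝ))⁻¹ ≤ 1 := by
  apply inv_le_one_of_one_le₀
  exact_mod_cast Nat.choose_pos (by omega)

lemma steklov_bound (r : ℕ) {δ : ℝ} (hδ : 0 < δ) {H : ℝ → ℝ} (hH : LI H) (x : ℝ) :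
    |steklov r δ H x| ≤ (2 * r * ∑ ν ∈ Finset.range r, ((2 * r).choose ν : ℝ)) *
      Av δ (fun t => |H t|) (x - δ / 2) := by
  have hHa : LI (fun t => |H t|) := fun a b => (hH a b).abs
  set A := Av δ (fun t => |H t|) (x - δ / 2) with hA
  have hA' : ∫ t in (x - δ / 2)..(x + δ / 2), |H t| = δ * A := by
    rw [hA, Av_eq hδ.ne', show x - δ / 2 + δ = x + δ / 2 by ring]; field_simp
  have hterm : ∀ ν ∈ Finset.range r,
      |∫ t in (-(δ / 2))..(δ / 2), (-1 : ℝ) ^ ν * (((2 * r).choose ν : ℝ)) *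
        H (x + (((r : ℝ) - (ν : ℝ)) / (r : ℝ)) * t)| ≤ ((2 * r).choose ν : ℝ) * (r * (δ * A)) := by
    intro ν hν
    have hν' : ν < r := by simpa using hν
    have hr0 : (0:ℝ) < r := by exact_mod_cast (by omega : 0 < r)
    have hνr : (ν:ℝ) + 1 ≤ r := by exact_mod_cast hν'
    set c := ((r : ℝ) - (ν : ℝ)) / (r : ℝ) with hc
    have hc0 : 0 < c := by apply div_pos <;> linarith
    have hc1 : c ≤ 1 := by
      rw [hc, div_le_one hr0]; have : (0:ℝ) ≤ ν := Nat.cast_nonneg _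
      linarith
    have hcr : c⁻¹ ≤ r := by
      rw [hc, inv_div, div_le_iff₀ (by linarith)]; nlinarith
    rw [intervalIntegral.integral_const_mul, abs_mul, abs_mul, abs_pow, abs_neg, abs_one, one_pow,
      one_mul, Nat.abs_cast]
    gcongr
    calc |∫ t in (-(δ / 2))..(δ / 2), H (x + c * t)|
        ≤ ∫ t in (-(δ / 2))..(δ / 2), |H (x + c * t)| :=
          intervalIntegral.abs_integral_le_integral_abs (by linarith)
      _ = c⁻¹ * ∫ t in (x + c * (-(δ / 2)))..(x + c * (δ / 2)), |H t| :=
          intervalIntegral.integral_comp_add_mul (fun t => |H t|) hc0.ne' x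
      _ ≤ r * ∫ t in (x - δ / 2)..(x + δ / 2), |H t| := by
          gcongr
          · exact intervalIntegral.integral_nonneg (by nlinarith) fun _ _ => abs_nonneg _
          · exact intervalIntegral.integral_mono_interval (by nlinarith) (by nlinarith)
              (by nlinarith) (Filter.Eventually.of_forall fun _ => abs_nonneg _) (hHa _ _)
      _ = _ := by rw [hA']
  unfold steklov
  rw [intervalIntegral.integral_finsetSum fun i _ => steklov_integrand_li r hH x i _ _ _]
  have hA0 : 0 ≤ A := by
    rw [hA]; unfold Av
    exact intervalIntegral.integral_nonneg zero_le_one fun _ _ => abs_nonneg _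
  rw [abs_mul, abs_mul, abs_mul, abs_pow, abs_neg, abs_one, one_pow, one_mul,
    abs_of_nonneg (a := ((2 * r).choose r : ℝ)⁻¹) (by positivity),
    abs_of_nonneg (a := 2 / δ) (by positivity)]
  calc _ ≤ 1 * (2 / δ) * ∑ ν ∈ Finset.range r, ((2 * r).choose ν : ℝ) * (r * (δ * A)) := by
        gcongr
        · exact choose_inv_le r
        · exact (Finset.abs_sum_le_sum_abs _ _).trans (Finset.sum_le_sum hterm)
    _ = _ := by rw [← Finset.sum_mul]; field_simp

lemma steklov_identity {r : ℕ} (hr : 1 ≤ r) {δ : ℝ} (hδ : 0 < δ) {g : ℝ → ℝ} (hg : Continuous g)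
    (x : ℝ) : steklov r δ g x - g x = (-1 : ℝ) ^ (r + 1) * (((2 * r).choose r : ℝ))⁻¹ * δ⁻¹ *
      ∫ t in (-(δ / 2))..(δ / 2), Delta (2 * r) (t / r) g (x - t) := by
  have hr0 : (r:ℝ) ≠ 0 := by positivity
  have hcp : (((2 * r).choose r : ℝ)) ≠ 0 := by
    exact_mod_cast (Nat.choose_pos (by omega : r ≤ 2 * r)).ne'
  set I : ℕ → ℝ := fun ν => ∫ t in (-(δ / 2))..(δ / 2), (-1 : ℝ) ^ ν * (((2 * r).choose ν : ℝ)) *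
    g (x + (((r : ℝ) - (ν : ℝ)) / (r : ℝ)) * t) with hI
  have h1 : ∫ t in (-(δ / 2))..(δ / 2), Delta (2 * r) (t / r) g (x - t) =
      ∑ ν ∈ Finset.range (2 * r + 1), I ν := by
    rw [hI, ← intervalIntegral.integral_finsetSum
      fun i _ => steklov_integrand_li r hg.li x i _ _ _]
    congr 1
    ext t
    unfold Delta
    apply Finset.sum_congr rfl
    intro ν _
    congr 2
    push_cast
    field_simp
    ring
  have h2 : steklov r δ g x = (-1 : ℝ) ^ (r + 1) * (((2 * r).choose r : ℝ))⁻¹ * (2 / δ) *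
      ∑ ν ∈ Finset.range r, I ν := by
    unfold steklov
    rw [intervalIntegral.integral_finsetSum fun i _ => steklov_integrand_li r hg.li x i _ _ _]
  have hsym : ∀ ν, ν < r → I (2 * r - ν) = I ν := by
    intro ν hν
    simp only [hI]
    have hneg := intervalIntegral.integral_comp_neg (a := -(δ / 2)) (b := δ / 2)
      (fun t => (-1 : ℝ) ^ ν * (((2 * r).choose ν : ℝ)) *
        g (x + (((r : ℝ) - (ν : ℝ)) / (r : ℝ)) * t))
    rw [neg_neg] at hneg
    rw [← hneg, Nat.choose_symm (by omega),
      Nat.cast_sub (by omega)]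
    have he : (-1:ℝ) ^ (2 * r - ν) = (-1) ^ ν := by
      rw [← Nat.sub_add_cancel (show ν ≤ r by omega), neg_one_pow_eq_pow_mod_two,
        neg_one_pow_eq_pow_mod_two (n := ν)]
      congr 1; omega
    rw [he]
    apply intervalIntegral.integral_congr
    intro t _
    simp only []
    congr 2
    push_cast
    field_simp
    ring
  have hmid : I r = (-1 : ℝ) ^ r * (((2 * r).choose r : ℝ)) * (δ * g x) := by
    simp only [hI, sub_self, zero_div, zero_mul, add_zero, intervalIntegral.integral_const,
      smul_eq_mul]
    ring
  have h3 : ∑ ν ∈ Finset.range (2 * r + 1), I ν = 2 * ∑ ν ∈ Finset.range r, I ν + I r := by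
    rw [show 2 * r + 1 = (r + 1) + r by ring, Finset.sum_range_add, Finset.sum_range_succ]
    have : ∑ ν ∈ Finset.range r, I (r + 1 + ν) = ∑ ν ∈ Finset.range r, I ν := by
      rw [← Finset.sum_range_reflect]
      apply Finset.sum_congr rfl
      intro ν hν
      have hν' : ν < r := by simpa using hν
      rw [← hsym ν hν']
      congr 1; omega
    rw [this]; ring
  rw [h1, h2, h3, hmid]
  have hsq : (-1 : ℝ) ^ (r + 1) * (-1) ^ r = -1 := by
    rw [← pow_add, show r + 1 + r = 2 * r + 1 by ring, pow_succ, pow_mul]; simp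
  have : (-1 : ℝ) ^ (r + 1) * (((2 * r).choose r : ℝ))⁻¹ * δ⁻¹ *
    ((-1 : ℝ) ^ r * (((2 * r).choose r : ℝ)) * (δ * g x)) = - g x := by
    calc _ = ((-1 : ℝ) ^ (r + 1) * (-1) ^ r) * ((((2 * r).choose r : ℝ))⁻¹ *
          (((2 * r).choose r : ℝ))) * (δ⁻¹ * δ) * g x := by ring
      _ = _ := by rw [hsq, inv_mul_cancel₀ hcp, inv_mul_cancel₀ hδ.ne']; ring
  rw [mul_add, this]
  ring

lemma Delta_le_sup (m : ℕ) (u y B : ℝ) (F : ℝ → ℝ) (h : ∀ i ≤ m, |F (y + i * u)| ≤ B) :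
    |Delta m u F y| ≤ 2 ^ m * B := by
  rw [Delta_eq']
  refine (Finset.abs_sum_le_sum_abs _ _).trans ?_
  have : (2:ℝ) ^ m = ∑ k ∈ Finset.range (m + 1), (m.choose k : ℝ) := by
    exact_mod_cast (Nat.sum_range_choose m).symm
  rw [this, Finset.sum_mul]
  apply Finset.sum_le_sum
  intro k hk
  rw [abs_mul, abs_mul, abs_pow, abs_neg, abs_one, one_pow, one_mul, Nat.abs_cast]
  gcongr
  exact h k (by simpa [Nat.lt_succ_iff] using hk)

lemma steklov_smooth {r s : ℕ} (hr : 1 ≤ r) (hs : 1 ≤ s) (hsr : s ≤ 2 * r) {δ : ℝ} (hδ : 0 < δ)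
    {g : ℝ → ℝ} (hg : ContDiff ℝ s g) (x : ℝ) :
    |steklov r δ g x - g x| ≤ (2 ^ (2 * r) * δ ^ s) *
      Av δ (fun t => |iteratedDeriv s g t|) (x - δ / 2) := by
  obtain ⟨m, rfl⟩ := Nat.exists_eq_add_of_le' hs
  set A := Av δ (fun t => |iteratedDeriv (m + 1) g t|) (x - δ / 2) with hA
  have hA' : ∫ t in (x - δ / 2)..(x + δ / 2), |iteratedDeriv (m + 1) g t| = δ * A := by
    rw [hA, Av_eq hδ.ne', show x - δ / 2 + δ = x + δ / 2 by ring]; field_simp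
  have hA0 : 0 ≤ A := by
    rw [hA]; unfold Av
    exact intervalIntegral.integral_nonneg zero_le_one fun _ _ => abs_nonneg _
  have hr1 : (1:ℝ) ≤ r := by exact_mod_cast hr
  have hr0 : (0:ℝ) < r := by linarith
  have hpt : ∀ t ∈ Set.uIoc (-(δ / 2)) (δ / 2), ‖Delta (2 * r) (t / r) g (x - t)‖ ≤
      2 ^ (2 * r) * (δ ^ (m + 1) * A) := by
    intro t ht
    rw [Set.uIoc_of_le (by linarith)] at ht
    have htab : |t| ≤ δ / 2 := abs_le.2 ⟨ht.1.le, ht.2⟩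
    have hu : |t / r| ≤ δ := by
      rw [abs_div, Nat.abs_cast, div_le_iff₀ hr0]; nlinarith
    obtain ⟨q, hq⟩ := Nat.exists_eq_add_of_le' hsr
    rw [Real.norm_eq_abs, hq, Delta_add_order]
    have hmem : ∀ i : ℕ, i ≤ 2 * r → x - t + i * (t / r) ∈ Set.Icc (x - δ / 2) (x + δ / 2) := by
      intro i hi
      have hi' : (i:ℝ) ≤ 2 * r := by exact_mod_cast hi
      have h0 : (0:ℝ) ≤ i := Nat.cast_nonneg _
      have h1 : |((i:ℝ) - r) / r * t| ≤ δ / 2 := by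
        rw [abs_mul]
        have : |((i:ℝ) - r) / r| ≤ 1 := by
          rw [abs_div, Nat.abs_cast, div_le_one hr0, abs_le]; constructor <;> linarith
        calc _ ≤ 1 * |t| := by gcongr
          _ ≤ _ := by linarith
      have h2 : x - t + i * (t / r) = x + ((i:ℝ) - r) / r * t := by field_simp; ring
      rw [h2]
      rw [abs_le] at h1
      constructor <;> linarith
    have h3 := Delta_le_sup q (t / r) (x - t) (δ ^ (m + 1) * A) (Delta (m + 1) (t / r) g) ?_
    · refine h3.trans ?_
      gcongr
      · norm_num
      · omega
    · intro i hi
      have h4 := Delta_local m (t / r) (x - δ / 2) (x + δ / 2) hg (x - t + i * (t / r))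
        (hmem i (by omega)) (by
          have := hmem (i + (m + 1)) (by omega)
          push_cast at this
          convert this using 1
          ring)
      rw [hA'] at h4
      refine h4.trans ?_
      calc |t / r| ^ m * (δ * A) ≤ δ ^ m * (δ * A) := by gcongr
        _ = _ := by ring
  have h5 := intervalIntegral.norm_integral_le_of_norm_le_const hpt
  rw [Real.norm_eq_abs, show δ / 2 - -(δ / 2) = δ by ring, abs_of_pos hδ] at h5
  rw [steklov_identity hr hδ hg.continuous, abs_mul, abs_mul, abs_mul, abs_pow, abs_neg, abs_one,
    one_pow, one_mul, abs_of_nonneg (a := ((2 * r).choose r : ℝ)⁻¹) (by positivity),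
    abs_of_pos (inv_pos.2 hδ)]
  calc _ ≤ 1 * δ⁻¹ * (2 ^ (2 * r) * (δ ^ (m + 1) * A) * δ) := by
        gcongr
        exact choose_inv_le r
    _ = _ := by field_simp


/-! ### Smooth approximation -/

/-- Signed binomial coefficients of the `s`-th difference. -/
noncomputable def cf (s j : ℕ) : ℝ := (-1 : ℝ) ^ (s - j) * (s.choose j : ℝ)

/-- Iterated averages of differences. -/
noncomputable def EE (s : ℕ) (h : ℝ) (f : ℝ → ℝ) (m : ℕ) (v x : ℝ) : ℝ :=
  ∑ j ∈ Finset.range (s + 1), cf s j * ((Av (j * h))^[m] f) (x + j * v)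

lemma Av_iter_memLpT {p : ℝ} (hp : 1 ≤ p) (h : ℝ) {f : ℝ → ℝ} (hf : MemLpT p f) (m : ℕ) :
    MemLpT p ((Av h)^[m] f) := by
  induction m with
  | zero => exact hf
  | succ m ih => rw [Function.iterate_succ_apply']; exact (Av_memLpT hp h ih).1

lemma EE_memLpT {p : ℝ} (hp : 1 ≤ p) (s : ℕ) (h : ℝ) {f : ℝ → ℝ} (hf : MemLpT p f) (m : ℕ)
    (v : ℝ) : MemLpT p (EE s h f m v) := by
  unfold EE
  exact memLpT_sum hp _ fun j _ => memLpT_const_mul hp _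
    (memLpT_shift _ (Av_iter_memLpT hp _ hf m))

lemma EE_zero (s : ℕ) (h : ℝ) (f : ℝ → ℝ) (v : ℝ) : EE s h f 0 v = Delta s v f := by
  ext x
  rw [Delta_eq']; rfl

lemma EE_succ {p : ℝ} (hp : 1 ≤ p) (s : ℕ) (h : ℝ) {f : ℝ → ℝ} (hf : MemLpT p f) (m : ℕ)
    (v : ℝ) : EE s h f (m + 1) v = fun x => ∫ u in (0:ℝ)..1, EE s h f m (v + h * u) x := by
  ext x
  unfold EE
  have haff : ∀ (j : ℕ) (u : ℝ), x + j * (v + h * u) = x + j * v + j * h * u := by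
    intros; ring
  simp only [haff]
  rw [intervalIntegral.integral_finsetSum]
  · apply Finset.sum_congr rfl
    intro j _
    rw [intervalIntegral.integral_const_mul, Function.iterate_succ_apply']
    rfl
  · intro j _
    exact ((((Av_iter_memLpT hp _ hf m).li hp).comp_affine (x + j * v) (j * h)) 0 1).const_mul _

lemma EE_bound {p : ℝ} (hp : 1 ≤ p) {s : ℕ} (hs : 1 ≤ s) {h δ : ℝ} (hh : 0 < h) {f : ℝ → ℝ}
    (hf : MemLpT p f) (m : ℕ) (v : ℝ) (hv : 0 ≤ v) (hvm : v + m * h < δ) :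
    LpNorm p (EE s h f m v) ≤ omegaMod s p f δ := by
  induction m generalizing v with
  | zero =>
    rw [EE_zero]
    rcases hv.eq_or_lt with rfl | hv0
    · rw [Delta_h_zero hs, LpNorm_zero hp]; exact omega_nonneg _ _ _ _
    · exact le_omega hp s δ hf hv0 (by simpa using hvm)
  | succ m ih =>
    rw [EE_succ hp s h hf m v]
    refine (minkowski hp (fun u => EE s h f m (v + h * u)) ?_ _ ?_ ?_).2
    · unfold EE Function.uncurry
      apply Finset.measurable_sum
      intro j _
      have := (Av_iter_memLpT hp (j * h) hf m).2.1
      fun_prop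
    · rintro u ⟨hu0, hu1⟩
      refine ⟨EE_memLpT hp s h hf m _, ih _ (by positivity) ?_⟩
      push_cast at hvm
      nlinarith
    · intro u
      exact (EE_memLpT hp s h hf m _).1

lemma smooth_approx {p : ℝ} (hp : 1 ≤ p) {s : ℕ} (hs : 1 ≤ s) : ∃ C : ℝ, 0 ≤ C ∧
    ∀ f : ℝ → ℝ, MemLpT p f → ∀ δ : ℝ, 0 < δ → ∃ g, SobolevW s g ∧
      LpNorm p (fun x => f x - g x) ≤ omegaMod s p f δ ∧
      LpNorm p (iteratedDeriv s g) ≤ C * (δ ^ s)⁻¹ * omegaMod s p f δ := by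
  refine ⟨(∑ j ∈ Finset.range s, |(-(-1 : ℝ) ^ s * cf s (j + 1))|) * (2 * (s + 1)) ^ s,
    by positivity, ?_⟩
  intro f hf δ hδ
  set h := δ / (2 * (s + 1)) with hh
  have hh0 : 0 < h := by positivity
  set ω := omegaMod s p f δ with hω
  have hω0 : 0 ≤ ω := omega_nonneg _ _ _ _
  have hδh : δ = 2 * (s + 1) * h := by rw [hh]; field_simp
  set B : ℕ → ℝ → ℝ := fun j => (Av ((j + 1 : ℕ) * h))^[s] (Av ((j + 1 : ℕ) * h) f) with hB
  have hj0 : ∀ j : ℕ, 0 < ((j + 1 : ℕ) : ℝ) * h := fun j => by positivity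
  have hcont : ∀ j : ℕ, Continuous (Av ((j + 1 : ℕ) * h) f) := fun j =>
    Av_continuous (hj0 j).ne' (hf.li hp)
  have hBc := fun j => Av_iter_contDiff (hj0 j).ne' (hcont j) s
  have hBp : ∀ j, MemLpT p (B j) := fun j => Av_iter_memLpT hp _ (Av_memLpT hp _ hf).1 s
  set g : ℝ → ℝ := fun x => ∑ j ∈ Finset.range s, (-(-1 : ℝ) ^ s * cf s (j + 1)) * B j x with hg
  have hsq : (-1 : ℝ) ^ s * (-1) ^ s = 1 := by rw [← mul_pow]; simp
  have hfg : (fun x => f x - g x) = fun x => (-1 : ℝ) ^ s * EE s h f (s + 1) 0 x := by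
    ext x
    have h0 : ∀ m, (Av 0)^[m] f = f := by
      intro m
      induction m with
      | zero => rfl
      | succ m ih => rw [Function.iterate_succ_apply', ih, Av_zero]
    unfold EE
    rw [Finset.sum_range_succ', hg]
    simp only [Nat.cast_zero, zero_mul, h0, mul_zero, add_zero]
    rw [mul_add, Finset.mul_sum, cf]
    simp only [Nat.sub_zero, Nat.choose_zero_right, Nat.cast_one, mul_one]
    rw [← mul_assoc, hsq, one_mul, add_comm, sub_eq_add_neg, ← Finset.sum_neg_distrib]
    congr 1
    apply Finset.sum_congr rfl
    intro j _
    rw [Function.iterate_succ_apply, hB]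
    ring
  refine ⟨g, ⟨?_, ?_⟩, ?_, ?_⟩
  · exact (memLpT_sum hp _ fun j _ => memLpT_const_mul hp _ (hBp j)).1
  · exact ContDiff.sum fun j _ => contDiff_const.mul (hBc j).1
  · rw [hfg, LpNorm_const_mul hp, abs_pow, abs_neg, abs_one, one_pow, one_mul]
    apply EE_bound hp hs hh0 hf _ _ le_rfl
    rw [hδh]; push_cast; nlinarith
  · have hd : iteratedDeriv s g = fun x => ∑ j ∈ Finset.range s,
        ((-(-1 : ℝ) ^ s * cf s (j + 1)) * ((((j + 1 : ℕ) : ℝ) * h) ^ s)⁻¹) *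
          Av ((j + 1 : ℕ) * h) (Delta s ((j + 1 : ℕ) * h) f) x := by
      ext x
      rw [hg, iteratedDeriv_fun_sum fun j _ => (contDiff_const.mul (hBc j).1).contDiffAt]
      apply Finset.sum_congr rfl
      intro j _
      rw [iteratedDeriv_const_mul_field, (hBc j).2, Av_Delta _ _ _ (hf.li hp)]
      ring
    have hmd : ∀ j : ℕ, MemLpT p (Av ((j + 1 : ℕ) * h) (Delta s ((j + 1 : ℕ) * h) f)) :=
      fun j => (Av_memLpT hp _ (memLpT_Delta hp _ _ hf)).1
    rw [hd]
    refine (LpNorm_sum_le hp _ fun j _ => memLpT_const_mul hp _ (hmd j)).trans ?_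
    rw [Finset.sum_mul, Finset.sum_mul, Finset.sum_mul]
    apply Finset.sum_le_sum
    intro j hj
    have hj' : (j:ℝ) + 1 ≤ s := by exact_mod_cast (Finset.mem_range.1 hj)
    rw [LpNorm_const_mul hp, abs_mul, mul_assoc, mul_assoc, mul_assoc]
    apply mul_le_mul_of_nonneg_left _ (abs_nonneg _)
    have h1 : LpNorm p (Av ((j + 1 : ℕ) * h) (Delta s ((j + 1 : ℕ) * h) f)) ≤ ω := by
      refine (Av_memLpT hp _ (memLpT_Delta hp _ _ hf)).2.trans ?_
      apply le_omega hp s δ hf (hj0 j)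
      rw [hδh]; push_cast; nlinarith
    have h2 : |((((j + 1 : ℕ) : ℝ) * h) ^ s)⁻¹| ≤ (h ^ s)⁻¹ := by
      rw [abs_of_pos (by have := hj0 j; positivity)]
      gcongr
      have : (1:ℝ) ≤ (j + 1 : ℕ) := by push_cast; linarith [Nat.cast_nonneg (α := ℝ) j]
      nlinarith
    have h3 : (h ^ s)⁻¹ = (2 * ((s:ℝ) + 1)) ^ s * (δ ^ s)⁻¹ := by
      rw [hh, div_pow, inv_div]; rfl
    rw [← mul_assoc, ← h3]
    exact mul_le_mul h2 h1 (LpNorm_nonneg _ _) (by positivity)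


/-! ### Main estimates -/

lemma SobolevW.cd {s : ℕ} {g : ℝ → ℝ} (hg : SobolevW s g) : ContDiff ℝ s g := hg.2

lemma SobolevW.memLpT {p : ℝ} (hp : 1 ≤ p) {s : ℕ} {g : ℝ → ℝ} (hg : SobolevW s g) :
    MemLpT p g := memLpT_of_continuous hp hg.1 hg.cd.continuous

lemma SobolevW.memLpT_deriv {p : ℝ} (hp : 1 ≤ p) {s : ℕ} {g : ℝ → ℝ} (hg : SobolevW s g) :
    MemLpT p (iteratedDeriv s g) :=
  memLpT_of_continuous hp (periodic_iteratedDeriv hg.1 s) (hg.cd.continuous_iteratedDeriv s le_rfl)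

/-- The constant of the Steklov operator. -/
noncomputable def stC (r : ℕ) : ℝ := 2 * r * ∑ ν ∈ Finset.range r, ((2 * r).choose ν : ℝ)

lemma stC_nonneg (r : ℕ) : 0 ≤ stC r := by unfold stC; positivity

lemma ell_steklov {p γ : ℝ} (hp : 1 ≤ p) {X : ℕ → ℕ → ℝ} (hγ : 0 < γ) (hγ1 : γ ≤ 1)
    (hX : NodesOK γ X) {n : ℕ} (hn : 1 ≤ n) (r : ℕ) {H : ℝ → ℝ} (hH : MemLpT p H) :
    ellp p n (X n) (steklov r (γ / n) H) ≤ stC r * γ⁻¹ * LpNorm p H :=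
  ellp_le hp hγ hγ1 hX hn hH (stC_nonneg r)
    (fun x => steklov_bound r (by positivity) (hH.li hp) x)

lemma ell_steklov_smooth {p γ : ℝ} (hp : 1 ≤ p) {X : ℕ → ℕ → ℝ} (hγ : 0 < γ) (hγ1 : γ ≤ 1)
    (hX : NodesOK γ X) {n : ℕ} (hn : 1 ≤ n) {r s : ℕ} (hr : 1 ≤ r) (hs : 1 ≤ s) (hsr : s ≤ 2 * r)
    {g : ℝ → ℝ} (hg : SobolevW s g) :
    ellp p n (X n) (fun x => steklov r (γ / n) g x - g x) ≤
      2 ^ (2 * r) * γ⁻¹ * (((n:ℝ) ^ s)⁻¹ * LpNorm p (iteratedDeriv s g)) := by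
  have hn0 : (0:ℝ) < n := by exact_mod_cast hn
  have h1 := ellp_le (a := fun x => steklov r (γ / n) g x - g x) (C := 2 ^ (2 * r) * (γ / n) ^ s)
    hp hγ hγ1 hX hn (hg.memLpT_deriv hp) (by positivity)
    (fun x => steklov_smooth hr hs hsr (by positivity) hg.cd x)
  refine h1.trans ?_
  have h2 : (γ / n) ^ s ≤ ((n:ℝ) ^ s)⁻¹ := by
    rw [div_pow, div_eq_mul_inv]
    have : γ ^ s ≤ 1 := pow_le_one₀ hγ.le hγ1
    have h3 : 0 < ((n:ℝ) ^ s)⁻¹ := by positivity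
    nlinarith
  have := LpNorm_nonneg p (iteratedDeriv s g)
  calc _ ≤ 2 ^ (2 * r) * ((n:ℝ) ^ s)⁻¹ * γ⁻¹ * LpNorm p (iteratedDeriv s g) := by gcongr
    _ = _ := by ring

lemma G_memLpT {p : ℝ} (hp : 1 ≤ p) {X : ℕ → ℕ → ℝ} {φ : ℕ → ℕ → ℝ → ℝ}
    {G : ℕ → (ℝ → ℝ) → ℝ → ℝ} (hG : SamplingForm p X φ G) (n : ℕ) (f : ℝ → ℝ) :
    MemLpT p (G n f) := by
  have : G n f = fun x => ∑ k ∈ Finset.range n, f (X n k) * φ n k x := by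
    ext x; exact hG.2 n f x
  rw [this]
  exact memLpT_sum hp _ fun k _ => memLpT_const_mul hp _ (hG.1 n k)

lemma G_sub {p : ℝ} {X : ℕ → ℕ → ℝ} {φ : ℕ → ℕ → ℝ → ℝ}
    {G : ℕ → (ℝ → ℝ) → ℝ → ℝ} (hG : SamplingForm p X φ G) (n : ℕ) (f g : ℝ → ℝ) (x : ℝ) :
    G n (fun t => f t - g t) x = G n f x - G n g x := by
  simp only [hG.2, sub_mul, Finset.sum_sub_distrib]

lemma direct_est (p γ : ℝ) (r s : ℕ) (X : ℕ → ℕ → ℝ) (φ : ℕ → ℕ → ℝ → ℝ)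
    (G : ℕ → (ℝ → ℝ) → ℝ → ℝ)
    (hp : 1 ≤ p) (hr : 1 ≤ r) (hs : 1 ≤ s) (hsr : s ≤ 2 * r)
    (hγ0 : 0 < γ) (hγ1 : γ ≤ 1) (hX : NodesOK γ X) (hGform : SamplingForm p X φ G)
    (K1 : ℝ) (hK1 : 0 < K1) (hc1 : CondC1 p K1 X G) (K3 : ℝ) (hK3 : 0 < K3)
    (hc2' : CondC2' p K3 s G) : ∃ C : ℝ, 0 < C ∧ ∀ f, MemLpT p f → ∀ n : ℕ, 1 ≤ n →
        LpNorm p (fun x => f x - G n f x) ≤ C *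
        (ellp p n (X n) (fun x => steklov r (γ / (n : ℝ)) f x - f x) +
          omegaMod s p f (1 / (n : ℝ))) := by
  obtain ⟨C, hC, hCa⟩ := smooth_approx hp hs
  have hst := stC_nonneg r
  refine ⟨1 + K3 * C + K1 * (1 + stC r * γ⁻¹ + 2 ^ (2 * r) * γ⁻¹ * C), by positivity, ?_⟩
  intro f hf n hn
  have hn0 : (0:ℝ) < n := by exact_mod_cast hn
  obtain ⟨g, hg, hg1, hg2⟩ := hCa f hf (1 / n) (by positivity)
  set ω := omegaMod s p f (1 / (n:ℝ))
  have hω : 0 ≤ ω := omega_nonneg _ _ _ _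
  set e := ellp p n (X n) (fun x => steklov r (γ / (n : ℝ)) f x - f x) with he
  have he0 : 0 ≤ e := ellp_nonneg _ _ _ _
  have hgm := hg.memLpT hp
  have hfg := memLpT_sub hp hf hgm
  have hg3 : ((n:ℝ) ^ s)⁻¹ * LpNorm p (iteratedDeriv s g) ≤ C * ω := by
    calc _ ≤ ((n:ℝ) ^ s)⁻¹ * (C * ((1 / (n:ℝ)) ^ s)⁻¹ * ω) := by gcongr
      _ = _ := by rw [one_div, inv_pow, inv_inv]; field_simp
  have h1 := hc2' g hg n hn
  have h1' : LpNorm p (fun x => g x - G n g x) ≤ K3 * (C * ω) := by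
    refine h1.trans ?_
    rw [div_eq_mul_inv, mul_assoc]
    gcongr
  have h2 := hc1 _ hfg n hn
  have h3 : ellp p n (X n) (fun t => f t - g t) ≤
      e + stC r * γ⁻¹ * ω + 2 ^ (2 * r) * γ⁻¹ * (C * ω) := by
    have e1 : (fun t => f t - g t) = fun t => ((f t - steklov r (γ / n) f t) +
        steklov r (γ / n) (fun t => f t - g t) t) + (steklov r (γ / n) g t - g t) := by
      ext t; rw [steklov_sub r _ (hf.li hp) (hgm.li hp)]; ring
    have a1 := ellp_add_le hp n (X n) (fun t => (f t - steklov r (γ / n) f t) +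
        steklov r (γ / n) (fun t => f t - g t) t) (fun t => steklov r (γ / n) g t - g t)
    rw [← e1] at a1
    have a2 := ellp_add_le hp n (X n) (fun t => f t - steklov r (γ / n) f t)
        (fun t => steklov r (γ / n) (fun t => f t - g t) t)
    rw [ellp_neg, ← he] at a2
    have a3 := ell_steklov hp hγ0 hγ1 hX hn r hfg
    have a4 := ell_steklov_smooth hp hγ0 hγ1 hX hn hr hs hsr hg
    have a5 : stC r * γ⁻¹ * LpNorm p (fun x => f x - g x) ≤ stC r * γ⁻¹ * ω := by gcongr
    have a6 : 2 ^ (2 * r) * γ⁻¹ * (((n:ℝ) ^ s)⁻¹ * LpNorm p (iteratedDeriv s g)) ≤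
      2 ^ (2 * r) * γ⁻¹ * (C * ω) := by gcongr
    have a7 : (fun t => steklov r (γ / n) (fun t => f t - g t) t) =
      steklov r (γ / n) (fun t => f t - g t) := rfl
    rw [a7] at a2
    linarith
  have hdec : (fun x => f x - G n f x) = fun x => ((f x - g x) + (g x - G n g x)) -
      G n (fun t => f t - g t) x := by
    ext x; rw [G_sub hGform]; ring
  have hGg := memLpT_sub hp hgm (G_memLpT hp hGform n g)
  have b1 := LpNorm_sub_le hp (memLpT_add hp hfg hGg) (G_memLpT hp hGform n (fun t => f t - g t))
  have b2 := LpNorm_add_le hp hfg hGg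
  rw [hdec]
  have b3 : K1 * ellp p n (X n) (fun t => f t - g t) ≤
      K1 * (e + stC r * γ⁻¹ * ω + 2 ^ (2 * r) * γ⁻¹ * (C * ω)) := by gcongr
  have b4 : 0 ≤ (1 + K3 * C + K1 * (stC r * γ⁻¹ + 2 ^ (2 * r) * γ⁻¹ * C)) * e := by positivity
  have b5 : 0 ≤ K1 * ω := by positivity
  nlinarith

lemma inverse_est (p γ : ℝ) (r s : ℕ) (X : ℕ → ℕ → ℝ) (φ : ℕ → ℕ → ℝ → ℝ)
    (G : ℕ → (ℝ → ℝ) → ℝ → ℝ)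
    (hp : 1 ≤ p) (hr : 1 ≤ r) (hs : 1 ≤ s) (hsr : s ≤ 2 * r)
    (hγ0 : 0 < γ) (hγ1 : γ ≤ 1) (hX : NodesOK γ X) (hGform : SamplingForm p X φ G)
    (K2 : ℝ) (hK2 : 0 < K2) (hc1' : CondC1' p K2 X G) (K3 : ℝ) (hK3 : 0 < K3)
    (hc2' : CondC2' p K3 s G) : ∃ C : ℝ, 0 < C ∧ ∀ f, MemLpT p f → ∀ g, SobolevW s g →
      ∀ n : ℕ, 1 ≤ n → ellp p n (X n) (fun x => steklov r (γ / (n : ℝ)) f x - f x) +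
          omegaMod s p f (1 / (n : ℝ)) ≤ C * (LpNorm p (fun x => f x - G n f x) +
          LpNorm p (fun x => f x - g x) + ((n:ℝ) ^ s)⁻¹ * LpNorm p (iteratedDeriv s g)) := by
  have hst := stC_nonneg r
  refine ⟨stC r * γ⁻¹ + 2 ^ (2 * r) * γ⁻¹ + K2⁻¹ * (1 + K3) + (2 ^ s + 1), by positivity, ?_⟩
  intro f hf g hg n hn
  have hn0 : (0:ℝ) < n := by exact_mod_cast hn
  have hgm := hg.memLpT hp
  have hfg := memLpT_sub hp hf hgm
  set a := LpNorm p (fun x => f x - G n f x) with ha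
  set b := LpNorm p (fun x => f x - g x) with hb
  set d := ((n:ℝ) ^ s)⁻¹ * LpNorm p (iteratedDeriv s g) with hd
  have ha0 : 0 ≤ a := LpNorm_nonneg _ _
  have hb0 : 0 ≤ b := LpNorm_nonneg _ _
  have hL0 := LpNorm_nonneg p (iteratedDeriv s g)
  have hd0 : 0 ≤ d := by positivity
  have h3 : ellp p n (X n) (fun t => f t - g t) ≤ K2⁻¹ * (1 + K3) * (a + b + d) := by
    have h1 := hc1' _ hfg n hn
    have hdec : G n (fun t => f t - g t) = fun x => ((f x - g x) + (g x - G n g x)) -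
        (f x - G n f x) := by
      ext x; rw [G_sub hGform]; ring
    have hGg := memLpT_sub hp hgm (G_memLpT hp hGform n g)
    have hGf := memLpT_sub hp hf (G_memLpT hp hGform n f)
    have b1 := LpNorm_sub_le hp (memLpT_add hp hfg hGg) hGf
    have b2 := LpNorm_add_le hp hfg hGg
    rw [← hdec] at b1
    have b3 := hc2' g hg n hn
    rw [div_eq_mul_inv, mul_assoc, ← hd] at b3
    have b4 : K2 * ellp p n (X n) (fun t => f t - g t) ≤ (1 + K3) * (a + b + d) := by
      have : 0 ≤ K3 * (a + b) := by positivity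
      nlinarith
    rw [mul_assoc, ← div_eq_inv_mul, le_div_iff₀ hK2]
    linarith
  have h4 : ellp p n (X n) (fun x => steklov r (γ / (n : ℝ)) f x - f x) ≤
      stC r * γ⁻¹ * b + 2 ^ (2 * r) * γ⁻¹ * d + K2⁻¹ * (1 + K3) * (a + b + d) := by
    have e1 : (fun t => steklov r (γ / n) f t - f t) = fun t => (
        steklov r (γ / n) (fun t => f t - g t) t + (steklov r (γ / n) g t - g t)) +
        (g t - f t) := by
      ext t; rw [steklov_sub r _ (hf.li hp) (hgm.li hp)]; ring
    have a1 := ellp_add_le hp n (X n) (fun t =>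
        steklov r (γ / n) (fun t => f t - g t) t + (steklov r (γ / n) g t - g t))
        (fun t => g t - f t)
    rw [← e1, ellp_neg p n (X n) g f] at a1
    have a2 := ellp_add_le hp n (X n) (steklov r (γ / n) (fun t => f t - g t))
        (fun t => steklov r (γ / n) g t - g t)
    have a3 := ell_steklov hp hγ0 hγ1 hX hn r hfg
    have a4 := ell_steklov_smooth hp hγ0 hγ1 hX hn hr hs hsr hg
    linarith
  have h5 : omegaMod s p f (1 / (n:ℝ)) ≤ 2 ^ s * b + d := by
    apply csSup_le
    · exact ⟨_, 1 / (2 * (n:ℝ)), by positivity, by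
        rw [div_lt_div_iff₀ (by positivity) hn0]; linarith, rfl⟩
    · rintro y ⟨h, hh0, hh1, rfl⟩
      have e2 : Delta s h f = fun x => Delta s h (fun t => f t - g t) x + Delta s h g x := by
        ext x; rw [Delta_sub]; ring
      rw [e2]
      have c1 := LpNorm_add_le hp (memLpT_Delta hp s h hfg) (memLpT_Delta hp s h hgm)
      have c2 := LpNorm_Delta_le hp s h hfg
      have c3 := LpNorm_Delta_le_deriv hp s h hg.1 hg.cd
      have c4 : |h| ^ s * LpNorm p (iteratedDeriv s g) ≤ d := by
        rw [hd, ← inv_pow, abs_of_pos hh0]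
        gcongr
        rw [← one_div]; exact hh1.le
      linarith
  have q1 : 0 ≤ (stC r * γ⁻¹) * (a + d) := by positivity
  have q2 : 0 ≤ (2 ^ (2 * r) * γ⁻¹) * (a + b) := by positivity
  have q3 : 0 ≤ (2:ℝ) ^ s * (a + d) := by positivity
  nlinarith

lemma bernstein_est (p : ℝ) (s : ℕ) (X : ℕ → ℕ → ℝ) (φ : ℕ → ℕ → ℝ → ℝ)
    (G : ℕ → (ℝ → ℝ) → ℝ → ℝ)
    (hp : 1 ≤ p) (hGform : SamplingForm p X φ G)
    (K4 : ℝ) (hK4 : 0 < K4) (α : ℝ) (hα0 : 0 < α) (hαs : α < (s : ℝ))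
    (f : ℝ → ℝ) (hf : MemLpT p f) (hc4 : CondC4 p K4 s G f) (C : ℝ) (hC : 0 < C)
    (h : ∀ n : ℕ, 1 ≤ n → LpNorm p (fun x => f x - G n f x) ≤ C * (n : ℝ) ^ (-α)) :
    ∃ B : ℝ, 0 < B ∧ ∀ N : ℕ, SobolevW s (G (2 ^ N) f) ∧
      LpNorm p (iteratedDeriv s (G (2 ^ N) f)) ≤ B * ((2:ℝ) ^ ((s:ℝ) - α)) ^ N := by
  set q := (2:ℝ) ^ ((s:ℝ) - α) with hq
  have hq1 : 1 < q := Real.one_lt_rpow (by norm_num) (by linarith)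
  set w := (2:ℝ) ^ (-α) with hw
  have hw0 : 0 < w := by positivity
  have hqw : q = 2 ^ s * w := by
    rw [hq, hw, sub_eq_add_neg, Real.rpow_add (by norm_num), Real.rpow_natCast]
  have hGm : ∀ n, MemLpT p (G n f) := fun n => G_memLpT hp hGform n f
  have hC2 : ∀ N : ℕ, LpNorm p (fun x => f x - G (2 ^ N) f x) ≤ C * w ^ N := by
    intro N
    have := h (2 ^ N) Nat.one_le_two_pow
    push_cast at this
    rwa [← Real.rpow_natCast, ← Real.rpow_mul (by norm_num), mul_comm, mul_comm (N:ℝ),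
      Real.rpow_mul (by norm_num), Real.rpow_natCast, mul_comm] at this
  set D := LpNorm p (G 1 f) + C * (1 + w⁻¹) with hD
  have hL1 := LpNorm_nonneg p (G 1 f)
  have hD0 : 0 < D := by positivity
  have hdiff : ∀ N : ℕ, LpNorm p (fun x => G (2 ^ (N + 1)) f x - G (2 ^ N) f x) ≤
      D * w ^ (N + 1) := by
    intro N
    have e : (fun x => G (2 ^ (N + 1)) f x - G (2 ^ N) f x) = fun x =>
        (f x - G (2 ^ N) f x) - (f x - G (2 ^ (N + 1)) f x) := by ext x; ring
    have h1 := LpNorm_sub_le hp (memLpT_sub hp hf (hGm (2 ^ N)))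
      (memLpT_sub hp hf (hGm (2 ^ (N + 1))))
    rw [e]
    have h2 := hC2 N
    have h3 := hC2 (N + 1)
    have h4 : C * w ^ N = C * w⁻¹ * w ^ (N + 1) := by rw [pow_succ]; field_simp
    have h5 : 0 ≤ LpNorm p (G 1 f) * w ^ (N + 1) := by positivity
    rw [hD]
    linarith
  set B := K4 * D * q / (q - 1) with hB
  have hB0 : 0 < B := by have : 0 < q - 1 := by linarith
                         positivity
  have hBq : B * q = B + K4 * D * q := by
    rw [hB]; have : q - 1 ≠ 0 := by linarith
    field_simp; ring
  have hBge : K4 * D ≤ B := by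
    rw [hB, le_div_iff₀ (by linarith)]
    have : 0 < K4 * D := by positivity
    nlinarith
  refine ⟨B, hB0, fun N => ?_⟩
  induction N with
  | zero =>
    have h0 := hc4 0
    have e : (fun x => G (2 ^ 0) f x - Gprev G f 0 x) = G 1 f := by
      ext x; simp [Gprev]
    rw [e] at h0
    simp only [pow_zero, mul_one, mul_zero] at h0 ⊢
    refine ⟨h0.1, h0.2.trans (le_trans ?_ hBge)⟩
    gcongr
    rw [hD]
    have : 0 ≤ C * (1 + w⁻¹) := by positivity
    linarith
  | succ N ih =>
    have h0 := hc4 (N + 1)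
    have e : (fun x => G (2 ^ (N + 1)) f x - Gprev G f (N + 1) x) =
        fun x => G (2 ^ (N + 1)) f x - G (2 ^ N) f x := by
      ext x; simp [Gprev]
    rw [e] at h0
    obtain ⟨h1, h2⟩ := h0
    obtain ⟨i1, i2⟩ := ih
    have e2 : G (2 ^ (N + 1)) f = fun x => G (2 ^ N) f x +
        (G (2 ^ (N + 1)) f x - G (2 ^ N) f x) := by ext x; ring
    have hcd : SobolevW s (G (2 ^ (N + 1)) f) := by
      refine ⟨(hGm _).1, ?_⟩
      rw [e2]
      exact i1.2.add h1.2
    refine ⟨hcd, ?_⟩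
    have e3 : iteratedDeriv s (G (2 ^ (N + 1)) f) = fun x => iteratedDeriv s (G (2 ^ N) f) x +
        iteratedDeriv s (fun x => G (2 ^ (N + 1)) f x - G (2 ^ N) f x) x := by
      ext x
      conv_lhs => rw [e2]
      exact iteratedDeriv_fun_add i1.cd.contDiffAt h1.cd.contDiffAt
    rw [e3]
    refine (LpNorm_add_le hp (i1.memLpT_deriv hp) (h1.memLpT_deriv hp)).trans ?_
    have h3 : K4 * 2 ^ (s * (N + 1)) *
        LpNorm p (fun x => G (2 ^ (N + 1)) f x - G (2 ^ N) f x) ≤ K4 * D * q ^ (N + 1) := by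
      calc _ ≤ K4 * 2 ^ (s * (N + 1)) * (D * w ^ (N + 1)) := by gcongr; exact hdiff N
        _ = _ := by rw [hqw, mul_pow, ← pow_mul]; ring
    have h4 : B * q ^ (N + 1) = B * q ^ N + K4 * D * q ^ (N + 1) := by
      rw [pow_succ']
      linear_combination q ^ N * hBq
    linarith


theorem stmt10 (p γ : ℝ) (r s : ℕ) (X : ℕ → ℕ → ℝ) (φ : ℕ → ℕ → ℝ → ℝ)
    (G : ℕ → (ℝ → ℝ) → ℝ → ℝ)
    (hp : 1 ≤ p) (hr : 1 ≤ r) (hs : 1 ≤ s) (hsr : s ≤ 2 * r)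
    (hγ0 : 0 < γ) (hγ1 : γ ≤ 1) (hX : NodesOK γ X) (hGform : SamplingForm p X φ G)
    (K1 : ℝ) (hK1 : 0 < K1) (hc1 : CondC1 p K1 X G) (K2 : ℝ) (hK2 : 0 < K2) (hc1' : CondC1' p K2 X G) (K3 : ℝ) (hK3 : 0 < K3) (hc2' : CondC2' p K3 s G) (K4 : ℝ) (hK4 : 0 < K4)
    (α : ℝ) (hα0 : 0 < α) (hαs : α < (s : ℝ))
    (f : ℝ → ℝ) (hf : MemLpT p f) (hc4 : CondC4 p K4 s G f) :
    (∃ C : ℝ, 0 < C ∧ ∀ n : ℕ, 1 ≤ n →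
        LpNorm p (fun x => f x - G n f x) ≤ C * (n : ℝ) ^ (-α)) ↔
      (∃ C : ℝ, 0 < C ∧ ∀ n : ℕ, 1 ≤ n →
        ellp p n (X n) (fun x => steklov r (γ / (n : ℝ)) f x - f x) + omegaMod s p f (1 / (n : ℝ)) ≤ C * (n : ℝ) ^ (-α)) := by
  constructor
  · rintro ⟨C, hC, h⟩
    obtain ⟨C', hC', hi⟩ := inverse_est p γ r s X φ G hp hr hs hsr hγ0 hγ1 hX hGform K2 hK2 hc1'
      K3 hK3 hc2'
    obtain ⟨B, hB, hb⟩ := bernstein_est p s X φ G hp hGform K4 hK4 α hα0 hαs f hf hc4 C hC h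
    refine ⟨C' * (C + (C + B) * 2 ^ α), by positivity, ?_⟩
    intro n hn
    have hn0 : (0:ℝ) < n := by exact_mod_cast hn
    set N := Nat.log 2 n
    have hN1 : 2 ^ N ≤ n := Nat.pow_log_le_self 2 (by omega)
    have hN2 : n < 2 ^ (N + 1) := Nat.lt_pow_succ_log_self (by norm_num) n
    have hN1' : (2:ℝ) ^ N ≤ n := by exact_mod_cast hN1
    have hN2' : (n:ℝ) ≤ 2 ^ N * 2 := by rw [← pow_succ]; exact_mod_cast hN2.le
    have hτ : ((2:ℝ) ^ N) ^ (-α) ≤ 2 ^ α * (n:ℝ) ^ (-α) := by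
      have h1 : ((2:ℝ) ^ N * 2) ^ (-α) ≤ (n:ℝ) ^ (-α) :=
        Real.rpow_le_rpow_of_nonpos hn0 hN2' (by linarith)
      rw [Real.mul_rpow (by positivity) (by norm_num)] at h1
      calc ((2:ℝ) ^ N) ^ (-α) = 2 ^ α * (((2:ℝ) ^ N) ^ (-α) * 2 ^ (-α)) := by
            rw [Real.rpow_neg (x := 2) (by norm_num)]; field_simp
        _ ≤ _ := by gcongr
    have h1 := hi f hf (G (2 ^ N) f) (hb N).1 n hn
    refine h1.trans ?_
    rw [mul_assoc]
    gcongr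
    have h2 := h n hn
    have h3 := h (2 ^ N) Nat.one_le_two_pow
    push_cast at h3
    have h4 : ((n:ℝ) ^ s)⁻¹ * LpNorm p (iteratedDeriv s (G (2 ^ N) f)) ≤
        B * ((2:ℝ) ^ N) ^ (-α) := by
      calc _ ≤ (((2:ℝ) ^ N) ^ s)⁻¹ * (B * ((2:ℝ) ^ ((s:ℝ) - α)) ^ N) := by
            gcongr
            · exact LpNorm_nonneg _ _
            · exact (hb N).2
        _ = _ := by
            have e : ((2:ℝ) ^ ((s:ℝ) - α)) ^ N = ((2:ℝ) ^ N) ^ s * ((2:ℝ) ^ N) ^ (-α) := by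
              rw [← Real.rpow_natCast ((2:ℝ) ^ N) s, ← Real.rpow_add (by positivity),
                ← Real.rpow_natCast, ← Real.rpow_natCast, ← Real.rpow_mul (by norm_num),
                ← Real.rpow_mul (by norm_num)]
              congr 1; ring
            rw [e]; field_simp
    have h5 : C * ((2:ℝ) ^ N) ^ (-α) ≤ C * (2 ^ α * (n:ℝ) ^ (-α)) := by gcongr
    have h6 : B * ((2:ℝ) ^ N) ^ (-α) ≤ B * (2 ^ α * (n:ℝ) ^ (-α)) := by gcongr
    linarith
  · rintro ⟨C, hC, h⟩
    obtain ⟨C', hC', hd⟩ := direct_est p γ r s X φ G hp hr hs hsr hγ0 hγ1 hX hGform K1 hK1 hc1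
      K3 hK3 hc2'
    refine ⟨C' * C, by positivity, fun n hn => (hd f hf n hn).trans ?_⟩
    rw [mul_assoc]
    gcongr
    exact h n hn
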